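/- arXiv:0903.5013 — 6 statements merged into one kernel-verified Lean document; each statement's English description precedes it below -/
import Mathlib

section
/- Let R be a commutative ring, x ∈ R a regular element, and M an R⋈xR-module. Then for every i ≥ 1 there are isomorphisms Tor_i^{R⋈xR}(M, R) ≅ Tor_{i+1}^{R⋈xR}(M, 0×xR) and Tor_i^{R⋈xR}(M, 0×xR) ≅ Tor_{i+1}^{R⋈xR}(M, R); in particular the Tor modules of R and 0×xR over R⋈xR are periodic of period 2 in degrees ≥ 1. -/
def amalg (R : Type*) [CommRing R] (I : Ideal R) : Subalgebra R (R × R) where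
  carrier := {p | ∃ r : R, ∃ e ∈ I, p = (r, r + e)}
  mul_mem' := by
    rintro p q ⟨r, e, he, rfl⟩ ⟨s, f, hf, rfl⟩
    exact ⟨r * s, r * f + s * e + e * f,
      add_mem (add_mem (I.mul_mem_left r hf) (I.mul_mem_left s he)) (I.mul_mem_right f he),
      by simp [Prod.ext_iff]; ring⟩
  add_mem' := by
    rintro p q ⟨r, e, he, rfl⟩ ⟨s, f, hf, rfl⟩
    exact ⟨r + s, e + f, add_mem he hf, by simp [Prod.ext_iff]; ring⟩
  algebraMap_mem' := fun r => ⟨r, 0, zero_mem I, by simp⟩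

def gx (R : Type*) [CommRing R] (x : R) : amalg R (Ideal.span {x}) :=
  ⟨(0, x), 0, x, Ideal.mem_span_singleton_self x, by simp⟩

def gx2 (R : Type*) [CommRing R] (x : R) : amalg R (Ideal.span {x}) :=
  ⟨(0, x ^ 2), 0, x ^ 2, Ideal.mem_span_singleton.mpr ⟨x, sq x⟩, by simp⟩

def epsHom (R : Type*) [CommRing R] (x : R) : amalg R (Ideal.span {x}) →+* R where
  toFun p := (p : R × R).1
  map_one' := rfl
  map_mul' _ _ := rfl
  map_zero' := rfl
  map_add' _ _ := rfl

open CategoryTheory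

/-- R is an R⋈xR-module via ε. -/
noncomputable instance epsModule {R : Type*} [CommRing R] {x : R} :
    Module (amalg R (Ideal.span {x})) R :=
  Module.compHom R (epsHom R x)

set_option synthInstance.maxHeartbeats 1000000

section general
open CategoryTheory Limits

universe v w v' w'

variable {C : Type w} [Category.{v} C] [Abelian C] [HasProjectiveResolutions C]
  {D : Type w'} [Category.{v'} D] [Abelian D]

/-- Left derived functors in positive degree, from the middle of a resolution. -/
noncomputable def leftDerivedIsoSc {X : C} (P : ProjectiveResolution X) (F : C ⥤ D) [F.Additive]
    (n : ℕ) : (F.leftDerived (n + 1)).obj X ≅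
      (F.mapShortComplex.obj (P.complex.sc' (n + 2) (n + 1) n)).homology :=
  P.isoLeftDerivedObj F (n + 1) ≪≫
    ShortComplex.homologyMapIso
      (((F.mapHomologicalComplex (ComplexShape.down ℕ)).obj P.complex).isoSc' (n + 2) (n + 1) n
        (by simp) (by simp))

/-- The periodic resolution. -/
theorem exists_periodic_resolution {A X : C} [Projective A] {φ ψ : A ⟶ A} (π : A ⟶ X)
    (h₁ : φ ≫ ψ = 0) (h₂ : ψ ≫ φ = 0) (h₃ : ψ ≫ π = 0) [Epi π]
    (e₁ : (ShortComplex.mk φ ψ h₁).Exact) (e₂ : (ShortComplex.mk ψ φ h₂).Exact)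
    (e₃ : (ShortComplex.mk ψ π h₃).Exact) :
    ∃ P : ProjectiveResolution X, P.complex =
      HomologicalComplex.alternatingConst A h₁ h₂
        (fun _ _ => ComplexShape.down_nat_odd_add) := by
  let K : ChainComplex C ℕ := HomologicalComplex.alternatingConst A h₁ h₂
        (fun _ _ => ComplexShape.down_nat_odd_add)
  have hd : K.d 1 0 = ψ := by simp [K]; rfl
  let p : K ⟶ (ChainComplex.single₀ C).obj X :=
    (ChainComplex.toSingle₀Equiv K X).symm ⟨π, by rw [hd]; exact h₃⟩
  have hp : p.f 0 = π := ChainComplex.toSingle₀Equiv_symm_apply_f_zero _ _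
  refine ⟨{ complex := K, projective := fun n => inferInstanceAs (Projective A), π := p,
            quasiIso := ⟨fun n => ?_⟩ }, rfl⟩
  cases n with
  | zero =>
    rw [ChainComplex.quasiIsoAt₀_iff, ShortComplex.quasiIso_iff_of_zeros']
    · refine ⟨?_, ?_⟩
      · have key : ∀ (f : A ⟶ A) (g : A ⟶ X) (w : f ≫ g = 0), f = ψ → g = π →
            (ShortComplex.mk f g w).Exact := by
          rintro f g w rfl rfl
          exact e₃
        exact key (K.d 1 0) (p.f 0) _ hd hp
      · have key : ∀ g : A ⟶ X, g = π → Epi g := by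
          rintro g rfl
          assumption
        exact key (p.f 0) hp
    all_goals rfl
  | succ n =>
    rw [quasiIsoAt_iff_exactAt' _ _ (ChainComplex.exactAt_succ_single_obj _ _)]
    rw [HomologicalComplex.exactAt_iff' _ (n + 2) (n + 1) n (by simp) (by simp)]
    by_cases h : Even (n + 1)
    · exact (ShortComplex.exact_iff_of_iso
        (HomologicalComplex.alternatingConstScIsoEven A h₁ h₂ _ (by simp) (by simp) h)).2 e₂
    · exact (ShortComplex.exact_iff_of_iso
        (HomologicalComplex.alternatingConstScIsoOdd A h₁ h₂ _ (by simp) (by simp)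
          (Nat.not_even_iff_odd.1 h))).2 e₁

theorem leftDerived_periodic {A X : C} [Projective A] {φ ψ : A ⟶ A} (π : A ⟶ X)
    (h₁ : φ ≫ ψ = 0) (h₂ : ψ ≫ φ = 0) (h₃ : ψ ≫ π = 0) [Epi π]
    (e₁ : (ShortComplex.mk φ ψ h₁).Exact) (e₂ : (ShortComplex.mk ψ φ h₂).Exact)
    (e₃ : (ShortComplex.mk ψ π h₃).Exact) (F : C ⥤ D) [F.Additive] (n : ℕ) :
    (Even (n + 1) → Nonempty ((F.leftDerived (n + 1)).obj X ≅
      (F.mapShortComplex.obj (ShortComplex.mk ψ φ h₂)).homology)) ∧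
    (Odd (n + 1) → Nonempty ((F.leftDerived (n + 1)).obj X ≅
      (F.mapShortComplex.obj (ShortComplex.mk φ ψ h₁)).homology)) := by
  obtain ⟨P, hP⟩ := exists_periodic_resolution π h₁ h₂ h₃ e₁ e₂ e₃
  have i := leftDerivedIsoSc P F n
  rw [hP] at i
  exact ⟨fun h => ⟨i ≪≫ ShortComplex.homologyMapIso (F.mapShortComplex.mapIso
      (HomologicalComplex.alternatingConstScIsoEven A h₁ h₂ _ (by simp) (by simp) h))⟩,
    fun h => ⟨i ≪≫ ShortComplex.homologyMapIso (F.mapShortComplex.mapIso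
      (HomologicalComplex.alternatingConstScIsoOdd A h₁ h₂ _ (by simp) (by simp) h))⟩⟩

theorem leftDerived_swap {A X Y : C} [Projective A] {φ ψ : A ⟶ A} (π : A ⟶ X) (ρ : A ⟶ Y)
    (h₁ : φ ≫ ψ = 0) (h₂ : ψ ≫ φ = 0) (h₃ : ψ ≫ π = 0) (h₄ : φ ≫ ρ = 0) [Epi π] [Epi ρ]
    (e₁ : (ShortComplex.mk φ ψ h₁).Exact) (e₂ : (ShortComplex.mk ψ φ h₂).Exact)
    (e₃ : (ShortComplex.mk ψ π h₃).Exact) (e₄ : (ShortComplex.mk φ ρ h₄).Exact)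
    (F : C ⥤ D) [F.Additive] (n : ℕ) (hn : 1 ≤ n) :
    Nonempty ((F.leftDerived n).obj X ≅ (F.leftDerived (n + 1)).obj Y) := by
  obtain ⟨n, rfl⟩ := Nat.exists_eq_add_of_le' hn
  have a := leftDerived_periodic π h₁ h₂ h₃ e₁ e₂ e₃ F n
  have b := leftDerived_periodic ρ h₂ h₁ h₄ e₂ e₁ e₄ F (n + 1)
  by_cases h : Even (n + 1)
  · obtain ⟨s⟩ := a.1 h
    obtain ⟨t⟩ := b.2 h.add_one
    exact ⟨s ≪≫ t.symm⟩
  · obtain ⟨s⟩ := a.2 (Nat.not_even_iff_odd.1 h)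
    obtain ⟨t⟩ := b.1 (Nat.not_even_iff_odd.1 h).add_one
    exact ⟨s ≪≫ t.symm⟩

end general

section modules
open CategoryTheory Limits

/-- Module version: `S` a commutative ring, `a b : S` with `Ann a = (b)`, `Ann b = (a)`,
`X ≅ S/(b)`, `Y ≅ S/(a)`. -/
theorem tor_swap {S : Type u} [CommRing S] (a b : S)
    (ha : ∀ s, a * s = 0 ↔ ∃ t, b * t = s) (hb : ∀ s, b * s = 0 ↔ ∃ t, a * t = s)
    (X Y : Type u) [AddCommGroup X] [Module S X] [AddCommGroup Y] [Module S Y]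
    (f : S →ₗ[S] X) (g : S →ₗ[S] Y) (hf : Function.Surjective f) (hg : Function.Surjective g)
    (hf' : ∀ s, f s = 0 ↔ ∃ t, b * t = s) (hg' : ∀ s, g s = 0 ↔ ∃ t, a * t = s)
    (M : ModuleCat.{u} S) (i : ℕ) (hi : 1 ≤ i) :
    Nonempty (((Tor (ModuleCat.{u} S) i).obj M).obj (ModuleCat.of S X) ≅
      ((Tor (ModuleCat.{u} S) (i + 1)).obj M).obj (ModuleCat.of S Y)) := by
  let φ : ModuleCat.of S S ⟶ ModuleCat.of S S := ModuleCat.ofHom (LinearMap.mulLeft S a)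
  let ψ : ModuleCat.of S S ⟶ ModuleCat.of S S := ModuleCat.ofHom (LinearMap.mulLeft S b)
  let π : ModuleCat.of S S ⟶ ModuleCat.of S X := ModuleCat.ofHom f
  let ρ : ModuleCat.of S S ⟶ ModuleCat.of S Y := ModuleCat.ofHom g
  have : Epi π := (ModuleCat.epi_iff_surjective _).2 hf
  have : Epi ρ := (ModuleCat.epi_iff_surjective _).2 hg
  have : Projective (ModuleCat.of S S) := ModuleCat.projective_of_free (Module.Basis.singleton Unit S)
  have h₁ : φ ≫ ψ = 0 := by
    ext
    simpa [φ, ψ] using (hb (a * 1)).2 ⟨1, rfl⟩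
  have h₂ : ψ ≫ φ = 0 := by
    ext
    simpa [φ, ψ] using (ha (b * 1)).2 ⟨1, rfl⟩
  have h₃ : ψ ≫ π = 0 := by
    ext
    simpa [π, ψ] using (hf' (b * 1)).2 ⟨1, rfl⟩
  have h₄ : φ ≫ ρ = 0 := by
    ext
    simpa [φ, ρ] using (hg' (a * 1)).2 ⟨1, rfl⟩
  refine leftDerived_swap π ρ h₁ h₂ h₃ h₄ ?_ ?_ ?_ ?_ _ i hi
  · exact (ShortComplex.moduleCat_exact_iff _).2 fun s hs => (hb s).1 hs
  · exact (ShortComplex.moduleCat_exact_iff _).2 fun s hs => (ha s).1 hs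
  · exact (ShortComplex.moduleCat_exact_iff _).2 fun s hs => (hf' s).1 hs
  · exact (ShortComplex.moduleCat_exact_iff _).2 fun s hs => (hg' s).1 hs

end modules

section amalgam
variable (R : Type u) [CommRing R] (x : R)

/-- The element `(x, 0)`. -/
def hxel : amalg R (Ideal.span {x}) :=
  ⟨(x, 0), x, -x, neg_mem (Ideal.mem_span_singleton_self x), by simp⟩

/-- The diagonal element `(r, r)`. -/
def diagel (r : R) : amalg R (Ideal.span {x}) :=
  ⟨(r, r), r, 0, zero_mem _, by simp⟩

/-- The linear map `ε`. -/
noncomputable def epsLin : amalg R (Ideal.span {x}) →ₗ[amalg R (Ideal.span {x})] R where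
  toFun p := epsHom R x p
  map_add' := map_add _
  map_smul' := map_mul (epsHom R x)

theorem gx_ann (hx : x ∈ nonZeroDivisors R) (s : amalg R (Ideal.span {x})) :
    gx R x * s = 0 ↔ ∃ t, hxel R x * t = s := by
  obtain ⟨⟨p, q⟩, r, e, he, h⟩ := s
  obtain ⟨c, rfl⟩ := Ideal.mem_span_singleton.1 he
  obtain ⟨h1, h2⟩ := Prod.mk.injEq .. ▸ h
  subst h1
  subst h2
  constructor
  · intro h
    have h2 : x * (p + x * c) = 0 := congrArg (fun z : amalg R (Ideal.span {x}) => (z : R × R).2) h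
    have h3 : p + x * c = 0 := (mul_right_mem_nonZeroDivisors_eq_zero_iff hx).1 (by rwa [mul_comm])
    refine ⟨diagel R x (-c), Subtype.ext (Prod.ext ?_ ?_)⟩
    · change x * (-c) = p
      linear_combination -h3
    · change 0 * (-c) = p + x * c
      linear_combination -h3
  · rintro ⟨⟨⟨t1, t2⟩, _⟩, ht⟩
    have h2 : 0 * t2 = p + x * c := congrArg (fun z : amalg R (Ideal.span {x}) => (z : R × R).2) ht
    refine Subtype.ext (Prod.ext ?_ ?_)
    · change 0 * p = 0
      simp
    · change x * (p + x * c) = 0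
      rw [← h2]; simp

theorem eps_ker (s : amalg R (Ideal.span {x})) :
    epsLin R x s = 0 ↔ ∃ t, gx R x * t = s := by
  obtain ⟨⟨p, q⟩, r, e, he, h⟩ := s
  obtain ⟨c, rfl⟩ := Ideal.mem_span_singleton.1 he
  obtain ⟨h1, h2⟩ := Prod.mk.injEq .. ▸ h
  subst h1
  subst h2
  constructor
  · intro h
    have h3 : p = 0 := h
    refine ⟨diagel R x c, Subtype.ext (Prod.ext ?_ ?_)⟩
    · change 0 * c = p
      linear_combination -h3
    · change x * c = p + x * c
      linear_combination -h3
  · rintro ⟨⟨⟨t1, t2⟩, _⟩, ht⟩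
    have h2 : 0 * t1 = p := congrArg (fun z : amalg R (Ideal.span {x}) => (z : R × R).1) ht
    change p = 0
    rw [← h2]; simp

theorem hx_ann (hx : x ∈ nonZeroDivisors R) (s : amalg R (Ideal.span {x})) :
    hxel R x * s = 0 ↔ ∃ t, gx R x * t = s := by
  rw [← eps_ker]
  change _ ↔ (s : R × R).1 = 0
  constructor
  · intro h
    have h2 : x * (s : R × R).1 = 0 := congrArg (fun z : amalg R (Ideal.span {x}) => (z : R × R).1) h
    exact (mul_right_mem_nonZeroDivisors_eq_zero_iff hx).1 (by rwa [mul_comm])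
  · intro h
    refine Subtype.ext (Prod.ext ?_ ?_)
    · change x * (s : R × R).1 = 0
      rw [h, mul_zero]
    · change 0 * (s : R × R).2 = 0
      simp

end amalgam

section ideals

/-- Multiplication onto a principal ideal. -/
noncomputable def toSpan {S : Type u} [CommRing S] (b : S) : S →ₗ[S] (Ideal.span {b} : Ideal S) :=
  LinearMap.codRestrict (Ideal.span {b} : Ideal S) (LinearMap.mulLeft S b)
    (fun s => Ideal.mul_mem_right _ _ (Ideal.mem_span_singleton_self b))

theorem toSpan_surj {S : Type u} [CommRing S] (b : S) : Function.Surjective (toSpan b) := by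
  rintro ⟨y, hy⟩
  obtain ⟨c, rfl⟩ := Ideal.mem_span_singleton.1 hy
  exact ⟨c, rfl⟩

theorem toSpan_eq_zero {S : Type u} [CommRing S] (b s : S) : toSpan b s = 0 ↔ b * s = 0 :=
  Subtype.ext_iff

end ideals

/-- for x regular and M an R⋈xR-module, for all i ≥ 1,
Tor_i(M, R) ≅ Tor_{i+1}(M, 0×xR) and Tor_i(M, 0×xR) ≅ Tor_{i+1}(M, R). -/
theorem tor_periodicity (R : Type u) [CommRing R] (x : R) (hx : x ∈ nonZeroDivisors R)
    (M : ModuleCat (amalg R (Ideal.span {x}))) (i : ℕ) (hi : 1 ≤ i) :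
    Nonempty (((Tor (ModuleCat (amalg R (Ideal.span {x}))) i).obj M).obj
        (ModuleCat.of (amalg R (Ideal.span {x})) R) ≅
      ((Tor (ModuleCat (amalg R (Ideal.span {x}))) (i + 1)).obj M).obj
        (ModuleCat.of (amalg R (Ideal.span {x})) (Ideal.span {gx R x}))) ∧
    Nonempty (((Tor (ModuleCat (amalg R (Ideal.span {x}))) i).obj M).obj
        (ModuleCat.of (amalg R (Ideal.span {x})) (Ideal.span {gx R x})) ≅
      ((Tor (ModuleCat (amalg R (Ideal.span {x}))) (i + 1)).obj M).obj
        (ModuleCat.of (amalg R (Ideal.span {x})) R)) := by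
  have hf : Function.Surjective (epsLin R x) := fun r => ⟨diagel R x r, rfl⟩
  have hg' : ∀ s, toSpan (gx R x) s = 0 ↔ ∃ t, hxel R x * t = s := fun s =>
    (toSpan_eq_zero _ s).trans (gx_ann R x hx s)
  exact ⟨tor_swap (hxel R x) (gx R x) (hx_ann R x hx) (gx_ann R x hx) _ _ (epsLin R x)
      (toSpan (gx R x)) hf (toSpan_surj _) (eps_ker R x) hg' M i hi,
    tor_swap (gx R x) (hxel R x) (gx_ann R x hx) (hx_ann R x hx) _ _ (toSpan (gx R x))
      (epsLin R x) (toSpan_surj _) hf hg' (eps_ker R x) M i hi⟩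
end

section
/- Let R be a commutative ring and I a proper ideal such that the canonical multiplication map R → Hom_R(I,I) is an isomorphism and Ext^i_R(I,I) = 0 for all i > 0. Then the injective dimension of R⋈I as a module over itself equals the injective dimension of I as an R-module. -/
open CategoryTheory

set_option synthInstance.maxHeartbeats 1000000

universe u

/-- Vanishing of the `Ext` defined through left derived functors agrees with vanishing of
the `Ext` defined through the derived category. -/
lemma oldExt_subsingleton_iff (A : Type u) [CommRing A] (X Y : ModuleCat.{u} A) (n : ℕ) :
    Subsingleton (((Ext A (ModuleCat.{u} A) (n + 1)).obj (Opposite.op X)).obj Y) ↔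
      Subsingleton (Abelian.Ext.{u} X Y (n + 1)) := by
  let P := projectiveResolution X
  have h1 : Subsingleton (((Ext A (ModuleCat.{u} A) (n + 1)).obj (Opposite.op X)).obj Y) ↔
      ∀ f : P.complex.X (n + 1) ⟶ Y, P.complex.d (n + 2) (n + 1) ≫ f = 0 →
        ∃ g : P.complex.X n ⟶ Y, P.complex.d (n + 1) n ≫ g = f := by
    rw [← ModuleCat.isZero_iff_subsingleton, (P.isoExt (R := A) (n + 1) Y).isZero_iff,
      ← HomologicalComplex.exactAt_iff_isZero_homology,
      HomologicalComplex.exactAt_iff' _ n (n + 1) (n + 2) (by simp) (by simp),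
      ShortComplex.moduleCat_exact_iff]
    exact Iff.rfl
  rw [h1]
  constructor
  · intro h
    refine subsingleton_of_forall_eq 0 fun e => ?_
    obtain ⟨f, hf, rfl⟩ := P.extMk_surjective e (n + 2) rfl
    rw [P.extMk_eq_zero_iff f (n + 2) rfl hf n rfl]
    exact h f hf
  · intro h f hf
    rw [← P.extMk_eq_zero_iff f (n + 2) rfl hf n rfl]
    exact Subsingleton.elim _ _

lemma oldExt_forall_iff (A : Type u) [CommRing A] (Y : ModuleCat.{u} A) (n : ℕ) :
    (∀ X : ModuleCat.{u} A,
      Subsingleton (((Ext A (ModuleCat.{u} A) (n + 1)).obj (Opposite.op X)).obj Y)) ↔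
      HasInjectiveDimensionLT Y (n + 1) := by
  simp only [oldExt_subsingleton_iff]
  exact ⟨fun h => hasInjectiveDimensionLT_of_enoughProjectives Y _ h,
    fun h X => HasInjectiveDimensionLT.subsingleton Y (n + 1) (n + 1) le_rfl X⟩

namespace AmalgAux

variable {R : Type u} [CommRing R] {I : Ideal R}

lemma snd_sub_fst_mem (s : amalg R I) : (s : R × R).2 - (s : R × R).1 ∈ I := by
  obtain ⟨_, r, e, he, rfl⟩ := s
  simpa using he

/-- The coextension functor along `R → R⋈I`. -/
noncomputable abbrev coind (I : Ideal R) : ModuleCat.{u} R ⥤ ModuleCat.{u} (amalg R I) :=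
  ModuleCat.coextendScalars.{u, u, u} (algebraMap R (amalg R I))

/-- The first projection. -/
def proj (I : Ideal R) : amalg R I →+* R where
  toFun p := (p : R × R).1
  map_one' := rfl
  map_mul' _ _ := rfl
  map_zero' := rfl
  map_add' _ _ := rfl

/-- The inclusion of `I`. -/
def inc (I : Ideal R) : I →ₗ[R] amalg R I where
  toFun e := ⟨(0, e), 0, e, e.2, by simp⟩
  map_add' x y := by ext <;> simp
  map_smul' r x := by ext <;> simp

/-- The difference of the coordinates. -/
def diff (I : Ideal R) : amalg R I →ₗ[R] I where
  toFun s := ⟨(s : R × R).2 - (s : R × R).1, snd_sub_fst_mem s⟩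
  map_add' x y := by ext; simp; ring
  map_smul' r x := by ext; simp; ring

/-- The first projection as a linear map. -/
def projL (I : Ideal R) : amalg R I →ₗ[R] R where
  toFun p := (p : R × R).1
  map_add' _ _ := rfl
  map_smul' _ _ := rfl

lemma decomp (s : amalg R I) :
    s = algebraMap R (amalg R I) (projL I s) + inc I (diff I s) := by
  ext
  · simp [projL, inc, diff]
  · simp [projL, inc, diff]

/-- `coind M` is the module of linear maps from `R⋈I`. -/
noncomputable def toLin {M : ModuleCat.{u} R} (g : (coind I).obj M) : amalg R I →ₗ[R] M where
  toFun s := ModuleCat.CoextendScalars.equiv _ M g s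
  map_add' x y := (ModuleCat.CoextendScalars.equiv _ M g).map_add x y
  map_smul' r x := by
    have := (ModuleCat.CoextendScalars.equiv _ M g).map_smul r x
    rw [Algebra.smul_def]
    exact this

/-- Inverse to `toLin`. -/
noncomputable def ofLin {M : ModuleCat.{u} R} (g : amalg R I →ₗ[R] M) : (coind I).obj M :=
  (ModuleCat.CoextendScalars.equiv _ M).symm
    { toFun := fun s => g s
      map_add' := fun x y => g.map_add x y
      map_smul' := fun r x => by
        have key : ∀ y : amalg R I, g (algebraMap R (amalg R I) r * y) = r • g y := fun y => by
          rw [← Algebra.smul_def, map_smul]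
        exact key x }

lemma toLin_ofLin {M : ModuleCat.{u} R} (g : amalg R I →ₗ[R] M) : toLin (ofLin g) = g := rfl

lemma toLin_inj {M : ModuleCat.{u} R} {g h : (coind I).obj M} (H : ∀ s, toLin g s = toLin h s) :
    g = h :=
  ModuleCat.CoextendScalars.ext (LinearMap.ext H)

lemma toLin_smul {M : ModuleCat.{u} R} (g : (coind I).obj M) (s t : amalg R I) :
    toLin (s • g) t = toLin g (t * s) := rfl

lemma toLin_add {M : ModuleCat.{u} R} (g h : (coind I).obj M) (t : amalg R I) :
    toLin (g + h) t = toLin g t + toLin h t := rfl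

lemma toLin_map {M N : ModuleCat.{u} R} (φ : M ⟶ N) (g : (coind I).obj M) (t : amalg R I) :
    toLin ((coind I).map φ g) t = φ (toLin g t) := rfl

/-- The canonical map `R⋈I → Hom_R(R⋈I, I)`. -/
noncomputable def danna (I : Ideal R) : amalg R I →ₗ[amalg R I] (coind I).obj (ModuleCat.of R I) where
  toFun s := ofLin (M := ModuleCat.of R I)
    ((diff I).comp (LinearMap.mulRight R s))
  map_add' x y := by
    apply toLin_inj
    intro t
    rw [toLin_add]
    simp only [toLin_ofLin, LinearMap.comp_apply, LinearMap.mulRight_apply]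
    rw [mul_add, map_add]
  map_smul' x y := by
    apply toLin_inj
    intro t
    rw [RingHom.id_apply, toLin_smul]
    simp only [toLin_ofLin, LinearMap.comp_apply, LinearMap.mulRight_apply]
    rw [smul_eq_mul, mul_assoc]

lemma danna_apply (s t : amalg R I) :
    toLin (danna I s) t = diff I (t * s) := rfl

lemma danna_bijective (hcan : Function.Bijective (LinearMap.lsmul R I)) :
    Function.Bijective (danna I) := by
  constructor
  · rw [injective_iff_map_eq_zero]
    intro s hs
    have h : ∀ t, diff I (t * s) = 0 := fun t => by
      rw [← danna_apply, hs]; rfl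
    have h1 : (s : R × R).2 - (s : R × R).1 = 0 := by
      have := congrArg Subtype.val (h 1)
      simpa [diff] using this
    have h2 : (s : R × R).2 = 0 := by
      apply hcan.1
      ext e
      have := congrArg Subtype.val (h (inc I e))
      simp [diff, inc] at this
      simpa [mul_comm] using this
    have h3 : (s : R × R).1 = 0 := by simpa [h2] using h1
    exact Subtype.ext (Prod.ext h3 h2)
  · intro g
    obtain ⟨c, hc⟩ := hcan.2 ((toLin g).comp (inc I))
    have hc' : ∀ e : I, c * (e : R) = ((toLin g (inc I e) : I) : R) := fun e =>
      congrArg Subtype.val (LinearMap.congr_fun hc e)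
    let f : I := toLin g 1
    refine ⟨⟨(c - f, c), c - f, f, f.2, by simp⟩, ?_⟩
    apply toLin_inj
    intro t
    rw [danna_apply]
    conv_rhs => rw [decomp t, map_add, Algebra.algebraMap_eq_smul_one, map_smul]
    apply Subtype.ext
    change _ = projL I t * (f : R) + ((toLin g (inc I (diff I t)) : I) : R)
    rw [← hc']
    simp [diff, projL]
    ring

/-- The canonical isomorphism. -/
noncomputable def dannaIso (hcan : Function.Bijective (LinearMap.lsmul R I)) :
    ModuleCat.of (amalg R I) (amalg R I) ≅ (coind I).obj (ModuleCat.of R I) :=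
  (LinearEquiv.ofBijective (danna I) (danna_bijective hcan)).toModuleIso

lemma injective_coind (M : ModuleCat.{u} R) [Injective M] : Injective ((coind I).obj M) :=
  Injective.injective_of_adjoint
    (ModuleCat.restrictCoextendScalarsAdj.{u, u, u} (algebraMap R (amalg R I))) M

/-- The map `s ↦ f (π(s) x)`. -/
noncomputable def pullLin {X M : ModuleCat.{u} R} (f : X ⟶ M) (x : X) : (coind I).obj M :=
  ofLin ((f.hom.comp (LinearMap.toSpanSingleton R X x)).comp (projL I))

lemma toLin_pullLin {X M : ModuleCat.{u} R} (f : X ⟶ M) (x : X) (t : amalg R I) :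
    toLin (pullLin f x) t = f.hom ((t : R × R).1 • x) := rfl

lemma pullLin_add {X M : ModuleCat.{u} R} (f : X ⟶ M) (x y : X) :
    (pullLin f (x + y) : (coind I).obj M) = pullLin f x + pullLin f y := by
  apply toLin_inj
  intro t
  rw [toLin_add, toLin_pullLin, toLin_pullLin, toLin_pullLin, smul_add, map_add]

lemma pullLin_smul {X M : ModuleCat.{u} R} (f : X ⟶ M) (s : amalg R I) (x : X) :
    (pullLin f ((s : R × R).1 • x) : (coind I).obj M) = s • pullLin f x := by
  apply toLin_inj
  intro t
  rw [toLin_smul, toLin_pullLin, toLin_pullLin, smul_smul]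
  rfl

lemma injective_of_coind (M : ModuleCat.{u} R) [hM : Injective ((coind I).obj M)] :
    Injective M := by
  refine ⟨fun {X Y} f g _ => ?_⟩
  let F : (ModuleCat.restrictScalars (proj I)).obj X ⟶ (coind I).obj M :=
    ModuleCat.ofHom (X := (ModuleCat.restrictScalars (proj I)).obj X)
      (Y := (coind I).obj M)
    { toFun := fun x => pullLin f x
      map_add' := fun x y => pullLin_add f x y
      map_smul' := fun s x => pullLin_smul f s x }
  have : Mono ((ModuleCat.restrictScalars (proj I)).map g) := inferInstance
  let H := Injective.factorThru F ((ModuleCat.restrictScalars (proj I)).map g)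
  have hH : (ModuleCat.restrictScalars (proj I)).map g ≫ H = F := Injective.comp_factorThru _ _
  have hsmul : ∀ (r : R) (y : Y), H.hom (r • y : Y) = algebraMap R (amalg R I) r • H.hom y :=
    fun r y => H.hom.map_smul (algebraMap R (amalg R I) r) y
  let h : Y →ₗ[R] M :=
    { toFun := fun y => toLin (H.hom y) 1
      map_add' := fun x y => by
        rw [← toLin_add]
        exact congrArg (fun k => toLin k 1) (H.hom.map_add x y)
      map_smul' := fun r y => by
        rw [hsmul, toLin_smul, one_mul, Algebra.algebraMap_eq_smul_one, map_smul]
        rfl }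
  refine ⟨ModuleCat.ofHom h, ?_⟩
  ext x
  have hx : H.hom (g x) = pullLin f x := congrArg (fun k => k.hom x) hH
  change toLin (H.hom (g x)) 1 = f x
  rw [hx, toLin_pullLin]
  change f ((1 : R) • x) = f x
  rw [one_smul]

lemma main_aux (n : ℕ) : ∀ (M : ModuleCat.{u} R),
    (∀ i : ℕ, Subsingleton (Abelian.Ext.{u} (ModuleCat.of R I) M (i + 1))) →
    (HasInjectiveDimensionLT ((coind I).obj M) (n + 1) ↔ HasInjectiveDimensionLT M (n + 1)) := by
  induction n with
  | zero =>
    intro M _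
    rw [zero_add, ← injective_iff_hasInjectiveDimensionLT_one,
      ← injective_iff_hasInjectiveDimensionLT_one]
    exact ⟨fun h => injective_of_coind (I := I) M, fun h => injective_coind M⟩
  | succ n ih =>
    intro M hM
    let S : ShortComplex (ModuleCat.{u} R) :=
      ShortComplex.mk (Injective.ι M) (Limits.cokernel.π (Injective.ι M)) (by simp)
    have hS : S.ShortExact :=
      { exact := ShortComplex.exact_cokernel _
        mono_f := inferInstanceAs (Mono (Injective.ι M))
        epi_g := inferInstanceAs (Epi (Limits.cokernel.π (Injective.ι M))) }
    have hE : Injective S.X₂ := inferInstanceAs (Injective (Injective.under M))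
    have hM' : ∀ i : ℕ, Subsingleton (Abelian.Ext.{u} (ModuleCat.of R I) S.X₃ (i + 1)) := by
      intro i
      refine subsingleton_of_forall_eq 0 fun e => ?_
      obtain ⟨e', rfl⟩ := Abelian.Ext.covariant_sequence_exact₃ _ hS e rfl
        ((hM (i + 1)).elim _ _)
      rw [e'.eq_zero_of_hasInjectiveDimensionLT 1 (by omega)]
      simp
    have hlift : ∀ f : I →ₗ[R] S.X₃, ∃ k : I →ₗ[R] S.X₂, S.g.hom.comp k = f := by
      intro f
      obtain ⟨e, he⟩ := Abelian.Ext.covariant_sequence_exact₃ _ hS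
        (Abelian.Ext.mk₀ (X := ModuleCat.of R I) (ModuleCat.ofHom f)) (zero_add 1)
        ((hM 0).elim _ _)
      obtain ⟨k, rfl⟩ := Abelian.Ext.homEquiv₀.symm.surjective e
      rw [Abelian.Ext.homEquiv₀_symm_apply, Abelian.Ext.mk₀_comp_mk₀] at he
      have := Abelian.Ext.homEquiv₀.symm.injective he
      exact ⟨k.hom, congrArg ModuleCat.Hom.hom this⟩
    have hzero : ∀ x, S.g.hom (S.f.hom x) = 0 := fun x =>
      LinearMap.congr_fun (congrArg ModuleCat.Hom.hom S.zero) x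
    have hinj : Function.Injective S.f.hom := (ModuleCat.mono_iff_injective _).1 hS.mono_f
    have hsurj : Function.Surjective S.g.hom := (ModuleCat.epi_iff_surjective _).1 hS.epi_g
    have hex : ∀ x, S.g.hom x = 0 → ∃ y, S.f.hom y = x :=
      (ShortComplex.moduleCat_exact_iff S).1 hS.exact
    let T : ShortComplex (ModuleCat.{u} (amalg R I)) :=
      ShortComplex.mk ((coind I).map S.f) ((coind I).map S.g) (by
        ext g t
        exact hzero _)
    have hT : T.ShortExact := by
      refine { exact := ?_, mono_f := ?_, epi_g := ?_ }
      · rw [ShortComplex.moduleCat_exact_iff]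
        intro g hg
        have h0 : ∀ t, S.g.hom (toLin g t) = 0 := fun t =>
          congrArg (fun k => toLin k t) hg
        refine ⟨ofLin ((LinearEquiv.ofInjective S.f.hom hinj).symm.toLinearMap.comp
          ((toLin g).codRestrict (LinearMap.range S.f.hom) fun t => hex _ (h0 t))), ?_⟩
        apply toLin_inj
        intro t
        change S.f.hom ((LinearEquiv.ofInjective S.f.hom hinj).symm _) = _
        rw [← LinearEquiv.ofInjective_apply (h := hinj), LinearEquiv.apply_symm_apply]
        rfl
      · rw [ModuleCat.mono_iff_injective]
        intro g g' h
        apply toLin_inj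
        intro t
        exact hinj (congrArg (fun k => toLin k t) h)
      · rw [ModuleCat.epi_iff_surjective]
        intro g
        obtain ⟨k, hk⟩ := hlift ((toLin g).comp (inc I))
        obtain ⟨z, hz⟩ := hsurj (toLin g 1)
        refine ⟨ofLin ((LinearMap.toSpanSingleton R S.X₂ z).comp (projL I) +
          k.comp (diff I)), ?_⟩
        apply toLin_inj
        intro t
        change S.g.hom (projL I t • z + k (diff I t)) = _
        conv_rhs => rw [decomp t, map_add, Algebra.algebraMap_eq_smul_one, map_smul]
        rw [map_add, map_smul, hz]
        congr 1
        exact LinearMap.congr_fun hk (diff I t)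
    have e1 := hS.hasInjectiveDimensionLT_X₃_iff n hE
    have e2 := hT.hasInjectiveDimensionLT_X₃_iff n (injective_coind S.X₂)
    exact e2.symm.trans ((ih S.X₃ hM').trans e1)

end AmalgAux

/-- if I is a proper ideal such that the multiplication map
R → Hom_R(I,I) is an isomorphism and Ext^i_R(I,I) = 0 for i > 0, then the
self-injective dimension of R⋈I equals the injective dimension of the R-module I
(expressed by the Ext-vanishing characterisation of injective dimension ≤ n). -/
theorem injective_dimension_amalg (R : Type u) [CommRing R] (I : Ideal R) (hI : I ≠ ⊤)
    (hcan : Function.Bijective (LinearMap.lsmul R I))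
    (hext : ∀ i : ℕ, 0 < i →
      Subsingleton (((Ext R (ModuleCat R) i).obj
        (Opposite.op (ModuleCat.of R I))).obj (ModuleCat.of R I))) :
    ∀ n : ℕ,
      (∀ N : ModuleCat (amalg R I),
        Subsingleton (((Ext (amalg R I) (ModuleCat (amalg R I)) (n + 1)).obj
          (Opposite.op N)).obj (ModuleCat.of (amalg R I) (amalg R I)))) ↔
      (∀ N : ModuleCat R,
        Subsingleton (((Ext R (ModuleCat R) (n + 1)).obj
          (Opposite.op N)).obj (ModuleCat.of R I))) := by
  intro n
  rw [oldExt_forall_iff, oldExt_forall_iff,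
    ← AmalgAux.main_aux (I := I) n (ModuleCat.of R I)
      (fun i => (oldExt_subsingleton_iff _ _ _ _).1 (hext (i + 1) i.succ_pos))]
  exact ⟨fun _ => hasInjectiveDimensionLT_of_iso (AmalgAux.dannaIso hcan) _,
    fun _ => hasInjectiveDimensionLT_of_iso (AmalgAux.dannaIso hcan).symm _⟩
end

section
/- Let R be a commutative ring and x ∈ R a regular element. Then the FP-injective dimension of R as an R-module equals the FP-injective dimension of R⋈xR as a module over itself. (The FP-injective dimension of M over S is the least n such that Ext^{n+1}_S(P, M) = 0 for every finitely presented S-module P.) -/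
open CategoryTheory

set_option synthInstance.maxHeartbeats 1000000

theorem ext_crit {A : Type u} [CommRing A] {X : ModuleCat.{u} A} (P : ProjectiveResolution X)
    (Y : ModuleCat.{u} A) (n : ℕ) :
    Subsingleton (((Ext A (ModuleCat.{u} A) (n + 1)).obj (Opposite.op X)).obj Y) ↔
      ∀ f : P.complex.X (n + 1) ⟶ Y, P.complex.d (n + 2) (n + 1) ≫ f = 0 →
        ∃ g : P.complex.X n ⟶ Y, P.complex.d (n + 1) n ≫ g = f := by
  rw [← ModuleCat.isZero_iff_subsingleton, (P.isoExt (R := A) (n + 1) Y).isZero_iff,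
    ← HomologicalComplex.exactAt_iff_isZero_homology,
    HomologicalComplex.exactAt_iff' _ n (n + 1) (n + 2) (by simp) (by simp),
    ShortComplex.moduleCat_exact_iff]
  rfl

theorem restrict_proj {R A : Type u} [CommRing R] [CommRing A] [Algebra R A]
    [Module.Projective R A] :
    (ModuleCat.restrictScalars.{u} (algebraMap R A)).PreservesProjectiveObjects where
  projective_obj {X} hX := by
    rw [← IsProjective.iff_projective] at hX
    letI : Module R X := Module.compHom X (algebraMap R A)
    haveI : IsScalarTower R A X := ⟨fun r a m => by
      rw [Algebra.smul_def, mul_smul]; rfl⟩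
    obtain ⟨s, hs⟩ := hX.out
    have : Module.Projective R (X →₀ A) := by
      classical
      exact Module.Projective.of_equiv (finsuppLequivDFinsupp (ι := X) (M := A) R).symm
    have : Module.Projective R X := Module.Projective.of_split (s.restrictScalars R)
      ((Finsupp.linearCombination A (id : X → X)).restrictScalars R)
      (LinearMap.ext fun m => hs m)
    exact (IsProjective.iff_projective (R := R) X).1 this

theorem key {R A : Type u} [CommRing R] [CommRing A] [Algebra R A]
    [Module.Projective R A] (lam : A →ₗ[R] R)
    (H : ∀ (M : Type u) [AddCommGroup M] [Module A M] [Module R M] [IsScalarTower R A M],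
      Function.Bijective (fun f : M →ₗ[A] A => lam ∘ₗ f.restrictScalars R))
    (Q : ModuleCat.{u} A) (n : ℕ) :
    Subsingleton (((Ext R (ModuleCat.{u} R) (n + 1)).obj (Opposite.op
      ((ModuleCat.restrictScalars.{u} (algebraMap R A)).obj Q))).obj (ModuleCat.of R R)) ↔
    Subsingleton (((Ext A (ModuleCat.{u} A) (n + 1)).obj (Opposite.op Q)).obj
      (ModuleCat.of A A)) := by
  haveI := restrict_proj (R := R) (A := A)
  let P := projectiveResolution Q
  rw [ext_crit P, ext_crit ((ModuleCat.restrictScalars.{u} (algebraMap R A)).mapProjectiveResolution P)]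
  let F := ModuleCat.restrictScalars.{u} (algebraMap R A)
  have key : ∃ T : ∀ M : ModuleCat.{u} A, (M ⟶ ModuleCat.of A A) → (F.obj M ⟶ ModuleCat.of R R),
      (∀ M, Function.Bijective (T M)) ∧
      (∀ M N (h : M ⟶ N) (f : N ⟶ ModuleCat.of A A), T M (h ≫ f) = F.map h ≫ T N f) ∧
      (∀ M, T M 0 = 0) := by
    have B : ∀ M : ModuleCat.{u} A, ∃ T : (M ⟶ ModuleCat.of A A) → (F.obj M ⟶ ModuleCat.of R R),
        Function.Bijective T ∧ ∀ f m, (T f).hom m = lam (f.hom m) := by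
      intro M
      letI : Module R M := Module.compHom M (algebraMap R A)
      haveI : IsScalarTower R A M := ⟨fun r a m => by
        rw [Algebra.smul_def, mul_smul]; rfl⟩
      let e : (M →ₗ[R] R) ≃ (F.obj M ⟶ ModuleCat.of R R) :=
        (ModuleCat.homEquiv (M := F.obj M) (N := ModuleCat.of R R)).symm
      refine ⟨fun f => e (lam ∘ₗ f.hom.restrictScalars R), ?_, fun f m => rfl⟩
      exact e.bijective.comp ((H M).comp ModuleCat.homEquiv.bijective)
    choose T hT hT' using B
    refine ⟨T, hT, fun M N h f => ?_, fun M => ?_⟩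
    · ext m
      erw [hT' M, hT' N]
      rfl
    · ext m
      erw [hT' M]
      exact map_zero lam
  obtain ⟨T, hT, hc, h0⟩ := key
  have hz : ∀ M f, T M f = 0 ↔ f = 0 := fun M f =>
    ⟨fun h => (hT M).1 (h.trans (h0 M).symm), fun h => h ▸ h0 M⟩
  change (∀ f : F.obj (P.complex.X (n + 1)) ⟶ _, F.map (P.complex.d (n + 2) (n + 1)) ≫ f = 0 →
        ∃ g : F.obj (P.complex.X n) ⟶ _, F.map (P.complex.d (n + 1) n) ≫ g = f) ↔ _
  rw [(hT _).2.forall]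
  refine forall_congr' fun f => ?_
  rw [← hc, hz]
  refine imp_congr Iff.rfl ?_
  rw [(hT _).2.exists]
  refine exists_congr fun g => ?_
  rw [← hc, (hT _).1.eq_iff]

theorem amalg_equiv (R : Type u) [CommRing R] (x : R) (hx : x ∈ nonZeroDivisors R) :
    ∃ e : (R × R) ≃ₗ[R] amalg R (Ideal.span {x}),
      ∀ a b, (e (a, b) : R × R) = (a, a + x * b) := by
  let e0 : (R × R) →ₗ[R] amalg R (Ideal.span {x}) :=
    { toFun := fun p => ⟨(p.1, p.1 + x * p.2), p.1, x * p.2,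
        Ideal.mem_span_singleton.mpr ⟨_, rfl⟩, rfl⟩
      map_add' := fun p q => by
        apply Subtype.ext
        simp [Prod.ext_iff]; ring
      map_smul' := fun r p => by
        apply Subtype.ext
        simp [Prod.ext_iff]; ring }
  refine ⟨LinearEquiv.ofBijective e0 ⟨?_, ?_⟩, fun a b => rfl⟩
  · rintro ⟨a, b⟩ ⟨c, d⟩ h
    have h' := congrArg Subtype.val h
    simp only [e0, LinearMap.coe_mk, AddHom.coe_mk, Prod.mk.injEq] at h'
    obtain ⟨rfl, h2⟩ := h'
    have := add_left_cancel h2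
    rw [mul_cancel_left_mem_nonZeroDivisors hx] at this
    rw [this]
  · rintro ⟨p, r, e, he, rfl⟩
    obtain ⟨b, rfl⟩ := Ideal.mem_span_singleton.mp he
    exact ⟨(r, b), rfl⟩

theorem amalg_frob (R : Type u) [CommRing R] (x : R) (hx : x ∈ nonZeroDivisors R) :
    ∃ lam : amalg R (Ideal.span {x}) →ₗ[R] R,
     ∀ (M : Type u) [AddCommGroup M] [Module (amalg R (Ideal.span {x})) M] [Module R M]
      [IsScalarTower R (amalg R (Ideal.span {x})) M],
      Function.Bijective (fun f : M →ₗ[amalg R (Ideal.span {x})] amalg R (Ideal.span {x}) =>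
        lam ∘ₗ f.restrictScalars R) := by
  obtain ⟨e, he⟩ := amalg_equiv R x hx
  let lam : amalg R (Ideal.span {x}) →ₗ[R] R := LinearMap.snd R R R ∘ₗ e.symm.toLinearMap
  have hl : ∀ a b, lam (e (a, b)) = b := fun a b => by simp [lam]
  have hg : ∀ a b, gx R x * e (a, b) = e (0, a + x * b) := fun a b => by
    apply Subtype.ext
    simp [he, gx]
  have hee : ∀ a b, e (a, b) = algebraMap R _ a + algebraMap R _ b * gx R x := fun a b => by
    apply Subtype.ext
    simp [he, gx, Prod.ext_iff, mul_comm]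
  have hgg : gx R x * gx R x = algebraMap R _ x * gx R x := by
    apply Subtype.ext
    simp [gx, Prod.ext_iff]
  refine ⟨lam, fun M _ _ _ _ => ⟨?_, ?_⟩⟩
  · intro f f' h
    have hm : ∀ m, lam (f m) = lam (f' m) := fun m => LinearMap.congr_fun h m
    ext1 m
    have h1 := hm m
    have h2 := hm (gx R x • m)
    rw [f.map_smul, f'.map_smul, smul_eq_mul, smul_eq_mul] at h2
    obtain ⟨⟨a, b⟩, h3⟩ := e.surjective (f m)
    obtain ⟨⟨c, d⟩, h4⟩ := e.surjective (f' m)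
    rw [← h3, ← h4] at h1 h2 ⊢
    simp only [hg, hl] at h1 h2
    subst h1
    rw [add_right_cancel h2]
  · intro φ
    have hs : ∀ (a b : R) (m : M), e (a, b) • m = a • m + b • (gx R x • m) := fun a b m => by
      rw [hee, add_smul, mul_smul, algebraMap_smul, algebraMap_smul]
    have hggm : ∀ m : M, gx R x • gx R x • m = x • gx R x • m := fun m => by
      rw [← mul_smul, hgg, mul_smul, algebraMap_smul]
    have hcomm : ∀ (a : R) (m : M), gx R x • a • m = a • gx R x • m := fun a m => by
      rw [← algebraMap_smul (amalg R (Ideal.span {x})) a m, smul_comm, algebraMap_smul]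
    refine ⟨{ toFun := fun m => e (φ (gx R x • m) - x * φ m, φ m), map_add' := ?_, map_smul' := ?_ }, ?_⟩
    · intro m m'
      rw [← map_add]
      simp only [smul_add, map_add, Prod.mk_add_mk]
      congr 2
      ring
    · intro s m
      obtain ⟨⟨a, b⟩, rfl⟩ := e.surjective s
      apply Subtype.ext
      simp only [hs, he, smul_add, map_add, hcomm, hggm, map_smul, smul_eq_mul, RingHom.id_apply,
        MulMemClass.coe_mul, Prod.mk_mul_mk, Prod.mk.injEq]
      constructor <;> ring
    · ext m
      exact hl _ _

/-- for x regular, the FP-injective dimension of R over R equals that of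
R⋈xR over itself: for each n, Ext^{n+1}(P,R) vanishes for all finitely presented
R-modules P iff Ext^{n+1}(Q,R⋈xR) vanishes for all finitely presented R⋈xR-modules Q. -/
theorem fp_injective_dimension_amalg (R : Type u) [CommRing R] (x : R)
    (hx : x ∈ nonZeroDivisors R) :
    ∀ n : ℕ,
      (∀ (P : Type u) [AddCommGroup P] [Module R P], Module.FinitePresentation R P →
        Subsingleton (((Ext R (ModuleCat R) (n + 1)).obj
          (Opposite.op (ModuleCat.of R P))).obj (ModuleCat.of R R))) ↔
      (∀ (Q : Type u) [AddCommGroup Q] [Module (amalg R (Ideal.span {x})) Q],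
        Module.FinitePresentation (amalg R (Ideal.span {x})) Q →
        Subsingleton (((Ext (amalg R (Ideal.span {x}))
            (ModuleCat (amalg R (Ideal.span {x}))) (n + 1)).obj
          (Opposite.op (ModuleCat.of (amalg R (Ideal.span {x})) Q))).obj
          (ModuleCat.of (amalg R (Ideal.span {x})) (amalg R (Ideal.span {x}))))) := by
  intro n
  obtain ⟨lam, H⟩ := amalg_frob R x hx
  obtain ⟨e, he⟩ := amalg_equiv R x hx
  haveI : Module.Projective R (amalg R (Ideal.span {x})) := Module.Projective.of_equiv e
  haveI : Module.FinitePresentation R (amalg R (Ideal.span {x})) :=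
    Module.FinitePresentation.of_equiv e
  constructor
  · intro h Q _ _ hQ
    rw [← key lam H]
    letI : Module R Q := Module.compHom Q (algebraMap R (amalg R (Ideal.span {x})))
    haveI : IsScalarTower R (amalg R (Ideal.span {x})) Q := ⟨fun r a m => by
        rw [Algebra.smul_def, mul_smul]; rfl⟩
    exact h Q (Module.FinitePresentation.trans (R := R) (M := Q) (amalg R (Ideal.span {x})))
  · intro h P _ _ hP
    letI : Algebra (amalg R (Ideal.span {x})) R := (epsHom R x).toAlgebra
    letI : Module (amalg R (Ideal.span {x})) P := Module.compHom P (epsHom R x)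
    haveI : IsScalarTower (amalg R (Ideal.span {x})) R P := ⟨fun r a m => by
        rw [Algebra.smul_def, mul_smul]; rfl⟩
    haveI : Module.FinitePresentation (amalg R (Ideal.span {x})) R := by
      refine Module.finitePresentation_of_surjective
        (Algebra.linearMap (amalg R (Ideal.span {x})) R) (fun r => ⟨algebraMap R _ r, rfl⟩) ?_
      refine ⟨{gx R x}, ?_⟩
      rw [Finset.coe_singleton]
      apply le_antisymm
      · rw [Submodule.span_singleton_le_iff_mem]
        rfl
      · rintro ⟨p, r, f, hf, rfl⟩ hp
        obtain ⟨b, rfl⟩ := Ideal.mem_span_singleton.mp hf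
        have hr : r = 0 := hp
        subst hr
        refine Submodule.mem_span_singleton.mpr ⟨algebraMap R _ b, ?_⟩
        apply Subtype.ext
        simp [gx, Prod.ext_iff, mul_comm]
    have hA := Module.FinitePresentation.trans (R := amalg R (Ideal.span {x})) (M := P) R
    have := (key lam H (ModuleCat.of (amalg R (Ideal.span {x})) P) n).2 (h P hA)
    have iso : (ModuleCat.restrictScalars.{u} (algebraMap R (amalg R (Ideal.span {x})))).obj
        (ModuleCat.of (amalg R (Ideal.span {x})) P) ≅ ModuleCat.of R P :=
      LinearEquiv.toModuleIso
        { AddEquiv.refl P with map_smul' := fun r p => rfl }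
    rw [← ModuleCat.isZero_iff_subsingleton] at this ⊢
    exact this.of_iso (((Ext R (ModuleCat.{u} R) (n + 1)).mapIso iso.op).app (ModuleCat.of R R))
end

section
/- Let R be a commutative ring containing a regular element x. Then the finitistic projective dimension of R⋈xR equals the finitistic projective dimension of R, i.e., FPD(R⋈xR) = FPD(R), where FPD(S) = sup{pd_S(M) : M an S-module with pd_S(M) < ∞}. -/
open CategoryTheory

set_option synthInstance.maxHeartbeats 1000000

/-- `Retr d k`: the image of `d k` is a direct summand (homotopy form). -/
def Retr {R : Type*} [CommRing R] {F : ℕ → Type*} [∀ i, AddCommGroup (F i)] [∀ i, Module R (F i)]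
    (d : ∀ i, F (i + 1) →ₗ[R] F i) (k : ℕ) : Prop :=
  ∃ h : F k →ₗ[R] F (k + 1), ∀ y, d k (h (d k y)) = d k y

theorem Retr.succ {R : Type*} [CommRing R] {F : ℕ → Type*} [∀ i, AddCommGroup (F i)]
    [∀ i, Module R (F i)] [∀ i, Module.Projective R (F i)]
    {d : ∀ i, F (i + 1) →ₗ[R] F i} (hd : ∀ i, Function.Exact (d (i + 1)) (d i)) {k : ℕ}
    (h : Retr d k) : Retr d (k + 1) := by
  obtain ⟨h, hh⟩ := h
  have key : ∀ y, y - h (d k y) ∈ LinearMap.range (d (k + 1)) := fun y => by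
    have := (hd k (y - h (d k y))).1 (by rw [map_sub, hh, sub_self])
    exact this
  obtain ⟨g, hg⟩ := Module.projective_lifting_property (d (k + 1)).rangeRestrict
    ((LinearMap.id - h ∘ₗ d k).codRestrict (LinearMap.range (d (k + 1))) key)
    (LinearMap.surjective_rangeRestrict _)
  refine ⟨g, fun y => ?_⟩
  have := congrArg Subtype.val (LinearMap.congr_fun hg (d (k + 1) y))
  simpa [(hd k).apply_apply_eq_zero] using this

theorem Retr.le {R : Type*} [CommRing R] {F : ℕ → Type*} [∀ i, AddCommGroup (F i)]
    [∀ i, Module R (F i)] [∀ i, Module.Projective R (F i)]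
    {d : ∀ i, F (i + 1) →ₗ[R] F i} (hd : ∀ i, Function.Exact (d (i + 1)) (d i)) {k l : ℕ}
    (hkl : k ≤ l) (h : Retr d k) : Retr d l := by
  induction hkl with
  | refl => exact h
  | step _ ih => exact ih.succ hd

theorem Retr.congr {R : Type*} [CommRing R] {F G : ℕ → Type*} [∀ i, AddCommGroup (F i)]
    [∀ i, Module R (F i)] [∀ i, AddCommGroup (G i)] [∀ i, Module R (G i)]
    (e : ∀ i, F i ≃ₗ[R] G i)
    {d : ∀ i, F (i + 1) →ₗ[R] F i} {k : ℕ} :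
    Retr d k ↔ Retr (fun i => (e i).toLinearMap ∘ₗ d i ∘ₗ (e (i + 1)).symm.toLinearMap) k := by
  constructor
  · rintro ⟨h, hh⟩
    exact ⟨(e (k + 1)).toLinearMap ∘ₗ h ∘ₗ (e k).symm.toLinearMap, fun y => by simp [hh]⟩
  · rintro ⟨h, hh⟩
    refine ⟨(e (k + 1)).symm.toLinearMap ∘ₗ h ∘ₗ (e k).toLinearMap, fun y => ?_⟩
    have := hh (e (k + 1) y)
    simpa using this

theorem exact_conj {R : Type*} [CommRing R] {F G : ℕ → Type*} [∀ i, AddCommGroup (F i)]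
    [∀ i, Module R (F i)] [∀ i, AddCommGroup (G i)] [∀ i, Module R (G i)]
    (e : ∀ i, F i ≃ₗ[R] G i)
    {d : ∀ i, F (i + 1) →ₗ[R] F i} (hd : ∀ i, Function.Exact (d (i + 1)) (d i)) (i : ℕ) :
    Function.Exact ((e (i + 1)).toLinearMap ∘ₗ d (i + 1) ∘ₗ (e (i + 1 + 1)).symm.toLinearMap)
      ((e i).toLinearMap ∘ₗ d i ∘ₗ (e (i + 1)).symm.toLinearMap) := by
  intro y
  have := hd i ((e (i + 1)).symm y)
  simp only [LinearMap.comp_apply, LinearEquiv.coe_coe, LinearEquiv.map_eq_zero_iff, this]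
  constructor
  · rintro ⟨z, hz⟩
    exact ⟨e (i + 1 + 1) z, by simp [hz]⟩
  · rintro ⟨z, hz⟩
    exact ⟨(e (i + 1 + 1)).symm z, by simp [← hz]⟩

/-- Elementary form of every module (in universe `w`) of projective dimension at most `m`
has projective dimension at most `n`. -/
def FP.{w, v} (R : Type v) [CommRing R] (n m : ℕ) : Prop :=
  ∀ (B : ℕ → Type w) (d : ∀ i, (B (i + 1) →₀ R) →ₗ[R] (B i →₀ R)),
    (∀ i, Function.Exact (d (i + 1)) (d i)) →
    Retr (F := fun i => B i →₀ R) d m → Retr (F := fun i => B i →₀ R) d n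

theorem FP.congr_basis.{w, w', v} {R : Type v} [CommRing R] {n m : ℕ} (H : FP.{w, v} R n m)
    (B : ℕ → Type w') (B' : ℕ → Type w) (e : ∀ i, B i ≃ B' i)
    (d : ∀ i, (B (i + 1) →₀ R) →ₗ[R] (B i →₀ R))
    (hd : ∀ i, Function.Exact (d (i + 1)) (d i)) (hm : Retr (F := fun i => B i →₀ R) d m) :
    Retr (F := fun i => B i →₀ R) d n := by
  let E : ∀ i, (B i →₀ R) ≃ₗ[R] (B' i →₀ R) := fun i => Finsupp.domLCongr (e i)
  rw [Retr.congr (F := fun i => B i →₀ R) E] at hm ⊢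
  exact H B' _ (exact_conj (F := fun i => B i →₀ R) E hd) hm

theorem FP.of_free.{w, v} {R : Type v} [CommRing R] {n m : ℕ} (H : FP.{w, v} R n m)
    {F : ℕ → Type*} [∀ i, AddCommGroup (F i)] [∀ i, Module R (F i)]
    (B : ℕ → Type w) (b : ∀ i, Module.Basis (B i) R (F i))
    (d : ∀ i, F (i + 1) →ₗ[R] F i)
    (hd : ∀ i, Function.Exact (d (i + 1)) (d i)) (hm : Retr d m) : Retr d n := by
  rw [Retr.congr (fun i => (b i).repr)] at hm ⊢
  exact H B _ (exact_conj (fun i => (b i).repr) hd) hm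

theorem FP.down.{w, v} {R : Type v} [CommRing R] {n m : ℕ} (H : FP.{max v w, v} R n m) :
    FP.{v, v} R n m := fun B d hd hm =>
  H.congr_basis B (fun i => ULift.{w} (B i)) (fun _ => Equiv.ulift.symm) d hd hm
section quot
variable {R : Type*} [CommRing R] {F Q : ℕ → Type*} [∀ i, AddCommGroup (F i)]
    [∀ i, Module R (F i)] [∀ i, AddCommGroup (Q i)] [∀ i, Module R (Q i)]

/-- A pair of subcomplexes `U ≤ V` with a complement `Q` of `U` in `V`. -/
structure QData (d : ∀ i, F (i + 1) →ₗ[R] F i) (U V : ∀ i, Submodule R (F i))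
    (inc : ∀ i, Q i →ₗ[R] F i) (pr : ∀ i, F i →ₗ[R] Q i) : Prop where
  le : ∀ i, U i ≤ V i
  pi : ∀ i q, pr i (inc i q) = q
  imem : ∀ i q, inc i q ∈ V i
  pU : ∀ i, ∀ y ∈ U i, pr i y = 0
  sub : ∀ i, ∀ y ∈ V i, y - inc i (pr i y) ∈ U i
  dU : ∀ i, ∀ y ∈ U (i + 1), d i y ∈ U i
  dV : ∀ i, ∀ y ∈ V (i + 1), d i y ∈ V i
  lU : ∀ i z, d i z ∈ U i → ∃ x ∈ U (i + 1), d i x = d i z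
  lV : ∀ i z, d i z ∈ V i → ∃ x ∈ V (i + 1), d i x = d i z

variable {d : ∀ i, F (i + 1) →ₗ[R] F i} {U V : ∀ i, Submodule R (F i)}
    {inc : ∀ i, Q i →ₗ[R] F i} {pr : ∀ i, F i →ₗ[R] Q i}

theorem QData.mem (D : QData d U V inc pr) {i : ℕ} {y : F i} (hy : y ∈ V i) (h : pr i y = 0) :
    y ∈ U i := by
  have := D.sub i y hy
  simpa [h] using this

theorem QData.comm (D : QData d U V inc pr) {i j : ℕ} (T : F i →ₗ[R] F j)
    (hT : ∀ y ∈ U i, T y ∈ U j) {y : F i} (hy : y ∈ V i) :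
    pr j (T (inc i (pr i y))) = pr j (T y) := by
  have := D.pU j _ (hT _ (D.sub i y hy))
  rw [map_sub, map_sub, sub_eq_zero] at this
  exact this.symm

theorem QData.exact (D : QData d U V inc pr) (hd : ∀ i, Function.Exact (d (i + 1)) (d i)) (i : ℕ) :
    Function.Exact (pr (i + 1) ∘ₗ d (i + 1) ∘ₗ inc (i + 1 + 1)) (pr i ∘ₗ d i ∘ₗ inc (i + 1)) := by
  intro q
  constructor
  · intro hq
    have h1 : d i (inc (i + 1) q) ∈ U i := D.mem (D.dV _ _ (D.imem _ _)) hq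
    obtain ⟨a, ha, hda⟩ := D.lU _ _ h1
    obtain ⟨z, hz⟩ := (hd i (inc (i + 1) q - a)).1 (by rw [map_sub, hda, sub_self])
    have h2 : d (i + 1) z ∈ V (i + 1) := by
      rw [hz]; exact sub_mem (D.imem _ _) (D.le _ ha)
    obtain ⟨z', hz', hdz⟩ := D.lV _ _ h2
    refine ⟨pr _ z', ?_⟩
    simp only [LinearMap.comp_apply]
    rw [D.comm (d (i + 1)) (D.dU _) hz', hdz, hz, map_sub, D.pi, D.pU _ _ ha, sub_zero]
  · rintro ⟨z, rfl⟩
    simp only [LinearMap.comp_apply]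
    rw [D.comm (d i) (D.dU _) (D.dV _ _ (D.imem _ _)), (hd i).apply_apply_eq_zero, map_zero]

theorem QData.retr (D : QData d U V inc pr) {m : ℕ} (k : F m →ₗ[R] F (m + 1))
    (hk : ∀ y, d m (k (d m y)) = d m y) (kU : ∀ y ∈ U m, k y ∈ U (m + 1))
    (kV : ∀ y ∈ V m, k y ∈ V (m + 1)) :
    Retr (fun i => pr i ∘ₗ d i ∘ₗ inc (i + 1)) m := by
  refine ⟨pr (m + 1) ∘ₗ k ∘ₗ inc m, fun q => ?_⟩
  simp only [LinearMap.comp_apply]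
  have h1 := D.dV _ _ (D.imem (m + 1) q)
  rw [D.comm (d m) (D.dU _) (kV _ (D.imem _ _))]
  have := D.comm (d m ∘ₗ k) (fun y hy => D.dU _ _ (kU _ hy)) h1
  simp only [LinearMap.comp_apply] at this
  rw [this, hk]

theorem QData.extend (D : QData d U V inc pr) {n : ℕ}
    (hQ : Retr (fun i => pr i ∘ₗ d i ∘ₗ inc (i + 1)) n)
    (H : F n →ₗ[R] F (n + 1)) (HU : ∀ y ∈ U n, H y ∈ U (n + 1))
    (Hd : ∀ y ∈ U (n + 1), d n (H (d n y)) = d n y) :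
    ∃ H' : F n →ₗ[R] F (n + 1), (∀ y ∈ V n, H' y ∈ V (n + 1)) ∧
      (∀ y ∈ V (n + 1), d n (H' (d n y)) = d n y) ∧ ∀ y ∈ U n, H' y = H y := by
  obtain ⟨g, hg⟩ := hQ
  simp only [LinearMap.comp_apply] at hg
  set G : F n →ₗ[R] F (n + 1) := inc (n + 1) ∘ₗ g ∘ₗ pr n with hG
  set H1 : F n →ₗ[R] F (n + 1) := H ∘ₗ (LinearMap.id - inc n ∘ₗ pr n) + G with hH1
  have GV : ∀ y, G y ∈ V (n + 1) := fun y => D.imem _ _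
  have GU : ∀ y ∈ U n, G y = 0 := fun y hy => by simp [hG, D.pU _ _ hy]
  have H1U : ∀ y ∈ U n, H1 y = H y := fun y hy => by simp [hH1, GU y hy, D.pU _ _ hy]
  have H1V : ∀ y ∈ V n, H1 y ∈ V (n + 1) := fun y hy =>
    add_mem (D.le _ (HU _ (by simpa using D.sub _ _ hy))) (GV y)
  have H1p : ∀ y ∈ V n, pr (n + 1) (H1 y) = g (pr n y) := fun y hy => by
    have := D.pU _ _ (HU _ (D.sub _ _ hy))
    simp only [hH1, hG, LinearMap.add_apply, LinearMap.comp_apply, LinearMap.sub_apply,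
      LinearMap.id_apply, map_add, this, D.pi, zero_add]
  have dH : ∀ y, d n y ∈ U n → d n (H (d n y)) = d n y := fun y hy => by
    obtain ⟨a, ha, h⟩ := D.lU _ _ hy
    rw [← h, Hd a ha]
  have pd : ∀ y ∈ V (n + 1), pr n (d n y) = pr n (d n (inc _ (pr _ y))) := fun y hy =>
    (D.comm (d n) (D.dU _) hy).symm
  -- the correction term
  have kU : ∀ w, d n (G w) - d n (H1 (d n (G w))) ∈ U n := fun w => by
    have hv := D.dV _ _ (GV w)
    refine D.mem (sub_mem hv (D.dV _ _ (H1V _ hv))) ?_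
    rw [map_sub, pd _ (H1V _ hv), H1p _ hv]
    simp only [hG, LinearMap.comp_apply, hg, sub_self]
  refine ⟨H1 + H ∘ₗ (LinearMap.id - d n ∘ₗ H1) ∘ₗ d n ∘ₗ G, ?_, ?_, ?_⟩
  · intro y hy
    exact add_mem (H1V y hy) (D.le _ (HU _ (by simpa using kU y)))
  · intro y hy
    have hdy := D.dV _ _ hy
    have e1 : d n (G (d n y) - y) ∈ U n := by
      refine D.mem (D.dV _ _ (sub_mem (GV _) hy)) ?_
      rw [map_sub, map_sub, pd y hy]
      simp only [hG, LinearMap.comp_apply]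
      rw [pd y hy, hg, sub_self]
    have e2 := dH _ e1
    rw [← H1U _ e1] at e2
    have e3 : d n (G (d n y)) - d n (H1 (d n (G (d n y)))) = d n (y - H1 (d n y)) := by
      simp only [map_sub] at e2 ⊢
      rw [← sub_eq_zero] at e2 ⊢
      rw [← neg_eq_zero, ← e2]
      abel
    have e4 := kU (d n y)
    rw [e3] at e4
    have e5 := dH _ e4
    simp only [LinearMap.add_apply, LinearMap.comp_apply, LinearMap.sub_apply, LinearMap.id_apply,
      map_add]
    rw [e3, e5, map_sub]
    abel
  · intro y hy
    simp [GU y hy, H1U y hy]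

end quot
section zorn
variable {R : Type*} [CommRing R] {B : ℕ → Type*}

/-- Elements supported on the degree `i` part of `A`. -/
abbrev sp (R : Type*) [CommRing R] {B : ℕ → Type*} (A : Set (Σ i, B i)) (i : ℕ) :
    Submodule R (B i →₀ R) :=
  Finsupp.supported R R {b | (⟨i, b⟩ : Σ i, B i) ∈ A}

theorem sp_mono {A A' : Set (Σ i, B i)} (h : A ⊆ A') (i : ℕ) : sp R A i ≤ sp R A' i :=
  Finsupp.supported_mono fun _ hb => h hb

/-- Subsets spanning a pure subcomplex, stable under `k`. -/
structure Good (d : ∀ i, (B (i + 1) →₀ R) →ₗ[R] (B i →₀ R)) {m : ℕ}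
    (k : (B m →₀ R) →ₗ[R] (B (m + 1) →₀ R)) (A : Set (Σ i, B i)) : Prop where
  dm : ∀ i, ∀ y ∈ sp R A (i + 1), d i y ∈ sp R A i
  lift : ∀ i z, d i z ∈ sp R A i → ∃ x ∈ sp R A (i + 1), d i x = d i z
  km : ∀ y ∈ sp R A m, k y ∈ sp R A (m + 1)

theorem exists_sp_of_chain {ι : Type*} (f : ι → Set (Σ i, B i)) (c : Set ι) (hne : c.Nonempty)
    (hc : DirectedOn (fun a b => f a ⊆ f b) c) {i : ℕ} {y : B i →₀ R}
    (hy : y ∈ sp R (⋃ a ∈ c, f a) i) : ∃ a ∈ c, y ∈ sp R (f a) i := by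
  classical
  obtain ⟨a, ha, h⟩ := DirectedOn.exists_mem_subset_of_finset_subset_biUnion (f := f) hne hc
    (s := y.support.map ⟨Sigma.mk i, sigma_mk_injective⟩) (by
      intro p hp
      simp only [Finset.coe_map, Function.Embedding.coeFn_mk, Set.mem_image] at hp
      obtain ⟨b, hb, rfl⟩ := hp
      exact hy hb)
  refine ⟨a, ha, fun b hb => h ?_⟩
  simp only [Finset.coe_map, Function.Embedding.coeFn_mk, Set.mem_image]
  exact ⟨b, hb, rfl⟩

theorem Good.biUnion {ι : Type*} (f : ι → Set (Σ i, B i)) (c : Set ι) (hne : c.Nonempty)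
    (hc : DirectedOn (fun a b => f a ⊆ f b) c)
    {d : ∀ i, (B (i + 1) →₀ R) →ₗ[R] (B i →₀ R)} {m : ℕ}
    {k : (B m →₀ R) →ₗ[R] (B (m + 1) →₀ R)} (hg : ∀ a ∈ c, Good d k (f a)) :
    Good d k (⋃ a ∈ c, f a) where
  dm i y hy := by
    obtain ⟨a, ha, h⟩ := exists_sp_of_chain f c hne hc hy
    exact sp_mono (Set.subset_biUnion_of_mem ha) _ ((hg a ha).dm i y h)
  lift i z hz := by
    obtain ⟨a, ha, h⟩ := exists_sp_of_chain f c hne hc hz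
    obtain ⟨x, hx, hxz⟩ := (hg a ha).lift i z h
    exact ⟨x, sp_mono (Set.subset_biUnion_of_mem ha) _ hx, hxz⟩
  km y hy := by
    obtain ⟨a, ha, h⟩ := exists_sp_of_chain f c hne hc hy
    exact sp_mono (Set.subset_biUnion_of_mem ha) _ ((hg a ha).km y h)

theorem small_sp.{v, w} {R : Type v} [CommRing R] {B : ℕ → Type w} (A : Set (Σ i, B i))
    [Small.{v} A] (i : ℕ) : Small.{v} (sp R A i) := by
  have : Small.{v} {b | (⟨i, b⟩ : Σ i, B i) ∈ A} :=
    small_of_injective (β := A) (f := fun b => ⟨⟨i, b.1⟩, b.2⟩) (by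
      rintro ⟨a, ha⟩ ⟨b, hb⟩ h
      simpa using h)
  exact small_of_injective (Finsupp.supportedEquivFinsupp (R := R) (M := R) _).injective

theorem exists_small_closed.{v, w} {R : Type v} [CommRing R] {B : ℕ → Type w}
    (op : ∀ i, (B i →₀ R) → Set (Σ i, B i)) (hop : ∀ i y, (op i y).Finite) (c : Σ i, B i) :
    ∃ Δ : Set (Σ i, B i), c ∈ Δ ∧ Small.{v} Δ ∧ ∀ i, ∀ y ∈ sp R Δ i, op i y ⊆ Δ := by
  let D : ℕ → Set (Σ i, B i) := fun k => Nat.rec {c}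
    (fun _ D => D ∪ ⋃ p : (Σ i, sp R D i), op p.1 p.2.1) k
  have hD : ∀ k, D (k + 1) = D k ∪ ⋃ p : (Σ i, sp R (D k) i), op p.1 p.2.1 := fun k => rfl
  have hs : ∀ k, Small.{v} ↥(D k) := by
    intro k
    induction k with
    | zero => exact inferInstanceAs (Small.{v} ({c} : Set (Σ i, B i)))
    | succ k ih =>
      rw [hD]
      have : ∀ i, Small.{v} ↥(sp R (D k) i) := fun i => @small_sp R _ B (D k) ih i
      have := fun (i) (y : B i →₀ R) => (hop i y).to_subtype
      have h2 := fun (i) (y : B i →₀ R) => (Countable.toSmall.{v} (op i y))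
      have h3 := @small_iUnion _ _ inferInstance
        (fun p : (Σ i, sp R (D k) i) => op p.1 p.2.1) (fun p => h2 _ _)
      exact @small_union _ _ _ ih h3
  have hmono : Monotone D := monotone_nat_of_le_succ fun k => by
    rw [hD]; exact Set.subset_union_left
  refine ⟨⋃ k ∈ (Set.univ : Set ℕ), D k, ?_, ?_, ?_⟩
  · simp only [Set.mem_univ, Set.iUnion_true, Set.mem_iUnion]
    exact ⟨0, rfl⟩
  · simp only [Set.mem_univ, Set.iUnion_true]
    exact @small_iUnion _ _ inferInstance D hs
  · intro i y hy
    obtain ⟨k, -, hk⟩ := exists_sp_of_chain D Set.univ ⟨0, trivial⟩ (fun a _ b _ =>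
      ⟨max a b, trivial, hmono (le_max_left _ _), hmono (le_max_right _ _)⟩) hy
    refine subset_trans ?_ (Set.subset_biUnion_of_mem (Set.mem_univ (k + 1)))
    rw [hD]
    exact subset_trans (Set.subset_iUnion (fun p : (Σ i, sp R (D k) i) => op p.1 p.2.1) ⟨i, y, hk⟩)
      Set.subset_union_right

theorem Good.extend.{v, w} {R : Type v} [CommRing R] {B : ℕ → Type w}
    {d : ∀ i, (B (i + 1) →₀ R) →ₗ[R] (B i →₀ R)} {m : ℕ}
    {k : (B m →₀ R) →ₗ[R] (B (m + 1) →₀ R)} {A : Set (Σ i, B i)} (hA : Good d k A)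
    (c : Σ i, B i) :
    ∃ Δ : Set (Σ i, B i), c ∈ Δ ∧ Small.{v} Δ ∧ Good d k (A ∪ Δ) := by
  classical
  let s : ∀ i, (B i →₀ R) → Set (Σ i, B i) := fun i y => Sigma.mk i '' (y.support : Set (B i))
  have sfin : ∀ i y, (s i y).Finite := fun i y => (Finset.finite_toSet _).image _
  have hsp : ∀ (Δ : Set (Σ i, B i)) i y, s i y ⊆ Δ → y ∈ sp R Δ i := fun Δ i y h b hb =>
    h ⟨b, hb, rfl⟩
  let X : ∀ i, (B i →₀ R) → (B (i + 1) →₀ R) := fun i y =>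
    if h : ∃ x, d i x - y ∈ sp R A i then h.choose else 0
  have hX : ∀ i y, (∃ x, d i x - y ∈ sp R A i) → d i (X i y) - y ∈ sp R A i := by
    intro i y h
    simp only [X, dif_pos h]
    exact h.choose_spec
  let o1 : ∀ i, (B i →₀ R) → Set (Σ i, B i) := fun i => match i with
    | 0 => fun _ => ∅
    | j + 1 => fun y => s j (d j y)
  let o3 : ∀ i, (B i →₀ R) → Set (Σ i, B i) := fun i y =>
    if h : i = m then s (m + 1) (k (h ▸ y)) else ∅
  obtain ⟨Δ, hc, hs, hcl⟩ := exists_small_closed (fun i y => o1 i y ∪ s (i + 1) (X i y) ∪ o3 i y)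
    (by
      intro i y
      refine ((Set.Finite.union ?_ (sfin _ _))).union ?_
      · cases i with
        | zero => exact Set.finite_empty
        | succ j => exact sfin _ _
      · simp only [o3]
        split_ifs
        · exact sfin _ _
        · exact Set.finite_empty) c
  have h1 : ∀ i, ∀ y ∈ sp R Δ (i + 1), d i y ∈ sp R Δ i := fun i y hy =>
    hsp _ _ _ (fun b hb => hcl _ y hy (Or.inl (Or.inl hb)))
  have h2 : ∀ i, ∀ y ∈ sp R Δ i, X i y ∈ sp R Δ (i + 1) := fun i y hy =>
    hsp _ _ _ (fun b hb => hcl _ y hy (Or.inl (Or.inr hb)))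
  have h3 : ∀ y ∈ sp R Δ m, k y ∈ sp R Δ (m + 1) := fun y hy =>
    hsp _ _ _ (fun b hb => hcl _ y hy (Or.inr (by simpa [o3] using hb)))
  have hun : ∀ i, sp R (A ∪ Δ) i = sp R A i ⊔ sp R Δ i := fun i =>
    Finsupp.supported_union _ _
  refine ⟨Δ, hc, hs, ⟨?_, ?_, ?_⟩⟩
  · intro i y hy
    rw [hun] at hy ⊢
    obtain ⟨a, ha, b, hb, rfl⟩ := Submodule.mem_sup.1 hy
    rw [map_add]
    exact Submodule.add_mem_sup (hA.dm _ _ ha) (h1 _ _ hb)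
  · intro i z hz
    rw [hun] at hz ⊢
    obtain ⟨a, ha, b, hb, hab⟩ := Submodule.mem_sup.1 hz
    have hb' := hX i b ⟨z, by rw [← hab]; simpa using ha⟩
    obtain ⟨x, hx, hxz⟩ := hA.lift i (z - X i b) (by
      rw [map_sub, ← hab, show a + b - d i (X i b) = a - (d i (X i b) - b) by abel]
      exact sub_mem ha hb')
    exact ⟨x + X i b, Submodule.add_mem_sup hx (h2 _ _ hb), by rw [map_add, hxz]; simp⟩
  · intro y hy
    rw [hun] at hy ⊢
    obtain ⟨a, ha, b, hb, rfl⟩ := Submodule.mem_sup.1 hy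
    rw [map_add]
    exact Submodule.add_mem_sup (hA.km _ ha) (h3 _ hb)

theorem Good.qdata
    {d : ∀ i, (B (i + 1) →₀ R) →ₗ[R] (B i →₀ R)} {m : ℕ}
    {k : (B m →₀ R) →ₗ[R] (B (m + 1) →₀ R)} {A Δ : Set (Σ i, B i)} (hA : Good d k A)
    (hA' : Good d k (A ∪ Δ)) :
    QData (F := fun i => B i →₀ R)
      (Q := fun i => ({b | (⟨i, b⟩ : Σ i, B i) ∈ Δ \ A} : Set (B i)) →₀ R) d
      (sp R A) (sp R (A ∪ Δ)) (fun _ => Finsupp.lmapDomain R R Subtype.val)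
      (fun _ => Finsupp.lsubtypeDomain _) where
  le i := sp_mono Set.subset_union_left i
  pi i q := by
    ext b
    exact Finsupp.mapDomain_apply Subtype.val_injective q b
  imem i q := by
    rw [Finsupp.mem_supported']
    intro b hb
    refine Finsupp.mapDomain_of_notMem_range _ _ ?_
    rintro ⟨b, rfl⟩
    exact hb (Or.inr b.2.1)
  pU i y hy := by
    ext b
    exact (Finsupp.mem_supported' _ _).1 hy _ b.2.2
  sub i y hy := by
    rw [Finsupp.mem_supported'] at hy ⊢
    intro b hb
    by_cases hb' : (⟨i, b⟩ : Σ i, B i) ∈ Δ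
    · have := Finsupp.mapDomain_apply Subtype.val_injective
        (Finsupp.lsubtypeDomain (R := R) {b | (⟨i, b⟩ : Σ i, B i) ∈ Δ \ A} y) ⟨b, hb', hb⟩
      simp only [Finsupp.lmapDomain_apply, Finsupp.sub_apply]
      rw [sub_eq_zero]
      exact this.symm
    · rw [Finsupp.sub_apply, hy b (by rintro (h | h); exacts [hb h, hb' h]), zero_sub, neg_eq_zero]
      refine Finsupp.mapDomain_of_notMem_range _ _ ?_
      rintro ⟨b, rfl⟩
      exact hb' b.2.1
  dU := hA.dm
  dV := hA'.dm
  lU := hA.lift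
  lV := hA'.lift

theorem FP.up.{v, w} {R : Type v} [CommRing R] {n m : ℕ} (H : FP.{v, v} R n m) :
    FP.{w, v} R n m := by
  classical
  intro B d hd ⟨k, hk⟩
  let T := {p : Set (Σ i, B i) × ((B n →₀ R) →ₗ[R] (B (n + 1) →₀ R)) //
    Good d k p.1 ∧ (∀ y ∈ sp R p.1 n, p.2 y ∈ sp R p.1 (n + 1)) ∧
      ∀ y ∈ sp R p.1 (n + 1), d n (p.2 (d n y)) = d n y}
  let r : T → T → Prop := fun a b => a.1.1 ⊆ b.1.1 ∧ ∀ y ∈ sp R a.1.1 n, a.1.2 y = b.1.2 y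
  have rrefl : ∀ a, r a a := fun a => ⟨subset_rfl, fun _ _ => rfl⟩
  have hbot : ∀ i, sp R (∅ : Set (Σ i, B i)) i = ⊥ := fun i => by
    simp [sp, Finsupp.supported_empty]
  have : Nonempty T := ⟨⟨(∅, 0), ⟨⟨fun i y hy => by
      rw [hbot, Submodule.mem_bot] at hy ⊢; simp [hy], fun i z hz => ⟨0, zero_mem _, by
      rw [hbot, Submodule.mem_bot] at hz; simp [hz]⟩, fun y hy => by
      rw [hbot, Submodule.mem_bot] at hy ⊢; simp [hy]⟩, fun y hy => zero_mem _, fun y hy => by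
      rw [hbot, Submodule.mem_bot] at hy; simp [hy]⟩⟩⟩
  obtain ⟨M, hM⟩ := exists_maximal_of_nonempty_chains_bounded (r := r) (by
    intro c hc hne
    have hdir : DirectedOn (fun a b : T => a.1.1 ⊆ b.1.1) c := by
      intro a ha b hb
      have : Std.Refl r := ⟨rrefl⟩
      rcases hc.total ha hb with h | h
      · exact ⟨b, hb, h.1, subset_rfl⟩
      · exact ⟨a, ha, subset_rfl, h.1⟩
    let h0 : B n → (B (n + 1) →₀ R) := fun b =>
      if h : ∃ a ∈ c, (⟨n, b⟩ : Σ i, B i) ∈ a.1.1 then h.choose.1.2 (Finsupp.single b 1) else 0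
    let h : (B n →₀ R) →ₗ[R] (B (n + 1) →₀ R) := Finsupp.linearCombination R h0
    have hh : ∀ a ∈ c, ∀ y ∈ sp R a.1.1 n, h y = a.1.2 y := by
      intro a ha
      have key : sp R a.1.1 n ≤ LinearMap.eqLocus h a.1.2 := by
        rw [sp, Finsupp.supported_eq_span_single, Submodule.span_le]
        rintro _ ⟨b, hb, rfl⟩
        have hex : ∃ a ∈ c, (⟨n, b⟩ : Σ i, B i) ∈ a.1.1 := ⟨a, ha, hb⟩
        obtain ⟨h1, h2⟩ := hex.choose_spec
        have : Std.Refl r := ⟨rrefl⟩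
        simp only [SetLike.mem_coe, LinearMap.mem_eqLocus, h, Finsupp.linearCombination_single,
          one_smul, h0, dif_pos hex]
        rcases hc.total ha h1 with h | h
        · exact (h.2 _ (Finsupp.single_mem_supported R _ hb)).symm
        · exact h.2 _ (Finsupp.single_mem_supported R _ h2)
      exact fun y hy => key hy
    let f : T → Set (Σ i, B i) := fun a => a.1.1
    refine ⟨⟨(⋃ a ∈ c, f a, h), Good.biUnion f c hne hdir fun a _ => a.2.1, ?_, ?_⟩, ?_⟩
    · intro y hy
      obtain ⟨a, ha, hy⟩ := exists_sp_of_chain f c hne hdir hy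
      simp only [hh a ha y hy]
      exact sp_mono (Set.subset_biUnion_of_mem ha) _ (a.2.2.1 y hy)
    · intro y hy
      obtain ⟨a, ha, hy⟩ := exists_sp_of_chain f c hne hdir hy
      simp only [hh a ha _ (a.2.1.dm _ _ hy)]
      exact a.2.2.2 y hy
    · intro a ha
      exact ⟨Set.subset_biUnion_of_mem (u := f) ha, fun y hy => (hh a ha y hy).symm⟩)
    (fun h1 h2 => ⟨h1.1.trans h2.1, fun y hy => (h1.2 y hy).trans (h2.2 y (sp_mono h1.1 _ hy))⟩)
  have huniv : M.1.1 = Set.univ := by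
    by_contra hne
    obtain ⟨c, hc⟩ := (Set.ne_univ_iff_exists_notMem _).1 hne
    obtain ⟨Δ, hcΔ, hs, hG⟩ := M.2.1.extend c
    have D := M.2.1.qdata hG
    have hsm : ∀ i, Small.{v} ({b | (⟨i, b⟩ : Σ i, B i) ∈ Δ \ M.1.1} : Set (B i)) := fun i =>
      small_of_injective (β := Δ) (f := fun b => ⟨⟨i, b.1⟩, b.2.1⟩) (by
        rintro ⟨a, ha⟩ ⟨b, hb⟩ h
        simpa using h)
    have hQ := H.congr_basis
      (fun i => ({b | (⟨i, b⟩ : Σ i, B i) ∈ Δ \ M.1.1} : Set (B i)))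
      (fun i => Shrink.{v} ({b | (⟨i, b⟩ : Σ i, B i) ∈ Δ \ M.1.1} : Set (B i)))
      (fun i => equivShrink _) _ (D.exact hd) (D.retr k hk M.2.1.km hG.km)
    obtain ⟨H', h1, h2, h3⟩ := D.extend hQ M.1.2 M.2.2.1 M.2.2.2
    have := hM ⟨(M.1.1 ∪ Δ, H'), hG, h1, h2⟩
      ⟨Set.subset_union_left, fun y hy => (h3 y hy).symm⟩
    exact hc (this.1 (Or.inr hcΔ))
  refine ⟨M.1.2, fun y => M.2.2.2 y ?_⟩
  rw [huniv]
  intro b _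
  trivial

end zorn
section ext
open Limits

theorem subsingleton_ext_iff.{w, v} {R : Type v} [CommRing R] {M : ModuleCat.{max v w} R}
    (P : ProjectiveResolution M) (k : ℕ) (N : ModuleCat.{max v w} R) :
    Subsingleton (((Ext R (ModuleCat.{max v w} R) (k + 1)).obj (Opposite.op M)).obj N) ↔
      ∀ f : P.complex.X (k + 1) ⟶ N, P.complex.d (k + 2) (k + 1) ≫ f = 0 →
        ∃ g : P.complex.X k ⟶ N, P.complex.d (k + 1) k ≫ g = f := by
  rw [(P.isoExt (R := R) (k + 1) N).toLinearEquiv.toEquiv.subsingleton_congr,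
    ← ModuleCat.isZero_iff_subsingleton,
    ← HomologicalComplex.exactAt_iff_isZero_homology,
    HomologicalComplex.exactAt_iff' _ k (k + 1) (k + 2) (by simp) (by simp),
    ShortComplex.moduleCat_exact_iff]
  rfl

/-- Projective resolution from an exact sequence of projective modules. -/
theorem exists_resolution.{w, v} {R : Type v} [CommRing R] (M : ModuleCat.{max v w} R)
    (F : ℕ → Type (max v w)) [∀ i, AddCommGroup (F i)] [∀ i, Module R (F i)]
    [∀ i, Module.Projective R (F i)]
    (d : ∀ i, F (i + 1) →ₗ[R] F i) (hd : ∀ i, Function.Exact (d (i + 1)) (d i))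
    (p : F 0 →ₗ[R] M) (hp : Function.Surjective p) (hdp : Function.Exact (d 0) p) :
    ∃ P : ProjectiveResolution M, P.complex = ChainComplex.of (fun i => ModuleCat.of R (F i))
      (fun i => ModuleCat.ofHom (d i)) (fun i => by
        ext y; exact (hd i).apply_apply_eq_zero y) := by
  have hsq : ∀ i, ModuleCat.ofHom (d (i + 1)) ≫ ModuleCat.ofHom (d i) = 0 := fun i => by
        ext y; exact (hd i).apply_apply_eq_zero y
  let K : ChainComplex (ModuleCat.{max v w} R) ℕ := ChainComplex.of (fun i => ModuleCat.of R (F i))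
      (fun i => ModuleCat.ofHom (d i)) hsq
  have hK : ∀ i, K.d (i + 1) i = ModuleCat.ofHom (d i) := fun i => 
    ChainComplex.of_d (fun i => ModuleCat.of R (F i)) (fun i => ModuleCat.ofHom (d i)) i
  have hexact : ∀ n, K.ExactAt (n + 1) := fun n => by
    rw [HomologicalComplex.exactAt_iff' _ (n + 1 + 1) (n + 1) n (by simp) (by simp),
      ShortComplex.moduleCat_exact_iff]
    intro y hy
    change (K.d (n + 1) n) y = 0 at hy
    change ∃ z, (K.d (n + 1 + 1) (n + 1)) z = y
    rw [hK] at hy ⊢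
    exact (hd n y).1 hy
  have hproj : ∀ n, Projective (K.X n) := fun n =>
    (IsProjective.iff_projective (R := R) (F n)).1 inferInstance
  have hzero : K.d 1 0 ≫ (ModuleCat.ofHom p : K.X 0 ⟶ M) = 0 := by
    rw [hK]; ext y; exact hdp.apply_apply_eq_zero y
  refine ⟨{ complex := K
            projective := hproj
            π := (ChainComplex.toSingle₀Equiv _ _).symm ⟨ModuleCat.ofHom p, hzero⟩
            quasiIso := ⟨fun n => ?_⟩ }, rfl⟩
  cases n with
  | zero =>
    rw [ChainComplex.quasiIsoAt₀_iff, ShortComplex.quasiIso_iff_of_zeros']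
    · have h0 : ((ChainComplex.toSingle₀Equiv K M).symm ⟨ModuleCat.ofHom p, hzero⟩).f 0
          = ModuleCat.ofHom p := ChainComplex.toSingle₀Equiv_symm_apply_f_zero _ _
      constructor
      · rw [ShortComplex.moduleCat_exact_iff]
        intro y hy
        change (((ChainComplex.toSingle₀Equiv K M).symm ⟨ModuleCat.ofHom p, hzero⟩).f 0) y = 0 at hy
        change ∃ z, (K.d 1 0) z = y
        rw [h0] at hy
        rw [hK]
        exact (hdp y).1 hy
      · change Epi (((ChainComplex.toSingle₀Equiv K M).symm ⟨ModuleCat.ofHom p, hzero⟩).f 0)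
        rw [h0]
        exact (ModuleCat.epi_iff_surjective _).2 hp
    · exact K.shape 0 0 (by simp)
    all_goals rfl
  | succ n =>
    rw [quasiIsoAt_iff_exactAt']
    · exact hexact n
    · apply ChainComplex.exactAt_succ_single_obj

theorem ext_iff_retr.{w, v} {R : Type v} [CommRing R] (M : ModuleCat.{max v w} R)
    (F : ℕ → Type (max v w)) [∀ i, AddCommGroup (F i)] [∀ i, Module R (F i)]
    [∀ i, Module.Projective R (F i)]
    (d : ∀ i, F (i + 1) →ₗ[R] F i) (hd : ∀ i, Function.Exact (d (i + 1)) (d i))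
    (p : F 0 →ₗ[R] M) (hp : Function.Surjective p) (hdp : Function.Exact (d 0) p) (k : ℕ) :
    (∀ N : ModuleCat.{max v w} R,
      Subsingleton (((Ext R (ModuleCat.{max v w} R) (k + 1)).obj (Opposite.op M)).obj N)) ↔
      Retr d k := by
  obtain ⟨P, hP⟩ := exists_resolution M F d hd p hp hdp
  have hdP : ∀ i, HEq (P.complex.d (i + 1) i) (ModuleCat.ofHom (d i)) := by
    intro i
    rw [hP]
    exact heq_of_eq (ChainComplex.of_d (fun i => ModuleCat.of R (F i))
      (fun i => ModuleCat.ofHom (d i)) i)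
  have hX : ∀ i, P.complex.X i = ModuleCat.of R (F i) := by
    intro i
    rw [hP]
  have key : ∀ N : ModuleCat.{max v w} R,
      Subsingleton (((Ext R (ModuleCat.{max v w} R) (k + 1)).obj (Opposite.op M)).obj N) ↔
      ∀ f : F (k + 1) →ₗ[R] N, f ∘ₗ d (k + 1) = 0 → ∃ g : F k →ₗ[R] N, g ∘ₗ d k = f := by
    intro N
    rw [subsingleton_ext_iff P]
    have h1 := hdP k
    have h2 := hdP (k + 1)
    have x1 := hX k
    have x2 := hX (k + 1)
    have x3 := hX (k + 2)
    change HEq (P.complex.d (k + 2) (k + 1)) _ at h2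
    generalize P.complex.d (k + 2) (k + 1) = D2 at *
    generalize P.complex.d (k + 1) k = D1 at *
    generalize P.complex.X (k + 2) = X2 at *
    generalize P.complex.X (k + 1) = X1 at *
    generalize P.complex.X k = X0 at *
    subst x1 x2 x3
    obtain rfl := eq_of_heq h1
    obtain rfl := eq_of_heq h2
    constructor
    · intro H f hf
      obtain ⟨g, hg⟩ := H (ModuleCat.ofHom f) (by
        rw [← ModuleCat.ofHom_comp, hf]; rfl)
      exact ⟨g.hom, congrArg ModuleCat.Hom.hom hg⟩
    · intro H f hf
      obtain ⟨g, hg⟩ := H f.hom (congrArg ModuleCat.Hom.hom hf)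
      refine ⟨ModuleCat.ofHom g, ModuleCat.hom_ext hg⟩
  simp only [key]
  constructor
  · intro H
    obtain ⟨g, hg⟩ := H (ModuleCat.of R (LinearMap.range (d k))) (d k).rangeRestrict (by
      ext y
      exact (hd k).apply_apply_eq_zero y)
    obtain ⟨h, hh⟩ := Module.projective_lifting_property (d k).rangeRestrict g
      (LinearMap.surjective_rangeRestrict _)
    refine ⟨h, fun y => ?_⟩
    have e1 := congrArg Subtype.val (LinearMap.congr_fun hh (d k y))
    have e2 := congrArg Subtype.val (LinearMap.congr_fun hg y)
    exact e1.trans e2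
  · rintro ⟨h, hh⟩ N f hf
    refine ⟨f ∘ₗ h, LinearMap.ext fun y => ?_⟩
    obtain ⟨z, hz⟩ := (hd k (y - h (d k y))).1 (by rw [map_sub, hh, sub_self])
    have := LinearMap.congr_fun hf z
    simp only [LinearMap.comp_apply, hz, map_sub, LinearMap.zero_apply, sub_eq_zero] at this
    exact this.symm

/-- Iterated syzygies for the canonical free resolution. -/
noncomputable def syz.{w, v} {R : Type v} [CommRing R] (M : ModuleCat.{max v w} R) :
    ℕ → ModuleCat.{max v w} R
  | 0 => M
  | i + 1 => ModuleCat.of R (LinearMap.ker (Finsupp.linearCombination R (id : syz M i → syz M i)))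

theorem fpd_iff_FP.{w, v} (R : Type v) [CommRing R] (n : ℕ) :
    (∀ M : ModuleCat.{max v w} R,
      (∃ m : ℕ, ∀ N : ModuleCat.{max v w} R,
        Subsingleton (((Ext R (ModuleCat.{max v w} R) (m + 1)).obj (Opposite.op M)).obj N)) →
      (∀ N : ModuleCat.{max v w} R,
        Subsingleton (((Ext R (ModuleCat.{max v w} R) (n + 1)).obj (Opposite.op M)).obj N))) ↔
    ∀ m, FP.{max v w, v} R n m := by
  constructor
  · intro H m B d hd hm
    have key := ext_iff_retr.{w, v} (ModuleCat.of R ((B 0 →₀ R) ⧸ LinearMap.range (d 0)))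
      (fun i => B i →₀ R) d hd (Submodule.mkQ _) (Submodule.mkQ_surjective _)
      (LinearMap.exact_map_mkQ_range (d 0))
    exact (key n).1 (H _ ⟨m, (key m).2 hm⟩)
  · rintro H M ⟨m, hm⟩
    let p : ∀ i, (syz.{w, v} M i →₀ R) →ₗ[R] syz.{w, v} M i := fun i =>
      Finsupp.linearCombination R (id : syz M i → syz M i)
    have hp : ∀ i, Function.Surjective (p i) := fun i => Finsupp.linearCombination_id_surjective R _
    let d : ∀ i, (syz.{w, v} M (i + 1) →₀ R) →ₗ[R] (syz.{w, v} M i →₀ R) := fun i =>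
      (LinearMap.ker (p i)).subtype ∘ₗ p (i + 1)
    have hdp : ∀ i, Function.Exact (d i) (p i) := by
      intro i y
      constructor
      · intro hy
        obtain ⟨z, hz⟩ := hp (i + 1) (⟨y, hy⟩ : LinearMap.ker (p i))
        refine ⟨z, ?_⟩
        change (LinearMap.ker (p i)).subtype (p (i + 1) z) = y
        rw [hz]
        rfl
      · rintro ⟨z, rfl⟩
        exact (show LinearMap.ker (p i) from p (i + 1) z).2
    have hd : ∀ i, Function.Exact (d (i + 1)) (d i) := by
      intro i y
      rw [← hdp (i + 1) y]
      exact Submodule.coe_eq_zero (p := LinearMap.ker (p i))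
    have key := ext_iff_retr.{w, v} M (fun i => syz.{w, v} M i →₀ R) d hd (p 0) (hp 0) (hdp 0)
    exact (key n).2 (H m (fun i => syz.{w, v} M i) d hd ((key m).1 hm))

end ext
section transfer

theorem down_step {R S : Type*} [CommRing R] [CommRing S] [Algebra R S] {F : ℕ → Type*}
    [∀ i, AddCommGroup (F i)] [∀ i, Module R (F i)] [∀ i, Module S (F i)]
    [∀ i, IsScalarTower R S (F i)] (t : S) (x : R) (α β : S →ₗ[R] R)
    (ht : t * t = algebraMap R S x * t)
    (hs : ∀ s, s = algebraMap R S (α s) + algebraMap R S (β s) * t)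
    (d : ∀ i, F (i + 1) →ₗ[S] F i) (hd : ∀ i, Function.Exact (d (i + 1)) (d i)) (k : ℕ)
    (L : F (k + 1) →ₗ[R] F (k + 1)) (hL : ∀ y, t • L y + L (t • y) - x • L y = y)
    (h1 : Retr d (k + 1)) (h2 : Retr (fun i => (d i).restrictScalars R) k) : Retr d k := by
  obtain ⟨g, hg⟩ := h1
  obtain ⟨h, hh⟩ := h2
  simp only [LinearMap.coe_restrictScalars] at hh
  let τ : F (k + 1) →ₗ[S] F (k + 1) := LinearMap.id - d (k + 1) ∘ₗ g
  have hτ : ∀ y, d k y = 0 → τ y = 0 := by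
    intro y hy
    obtain ⟨z, rfl⟩ := (hd k y).1 hy
    simp [τ, hg]
  have hdτ : ∀ y, d k (τ y) = d k y := by
    intro y
    simp [τ, (hd k).apply_apply_eq_zero]
  let θ : F k →ₗ[R] F (k + 1) := τ.restrictScalars R ∘ₗ h
  have hθ : ∀ y, θ (d k y) = τ y := by
    intro y
    have := hτ (h (d k y) - y) (by rw [map_sub, hh, sub_self])
    rwa [map_sub, sub_eq_zero] at this
  let T : F k → F (k + 1) := fun z => t • L (θ z) + L (θ (t • z)) - x • L (θ z)
  have Tadd : ∀ y z, T (y + z) = T y + T z := by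
    intro y z
    simp only [T, smul_add, map_add]
    abel
  have TR : ∀ (r : R) z, T (r • z) = r • T z := by
    intro r z
    simp only [T, smul_add, smul_sub, map_smul, smul_comm t r, smul_comm x r]
  have hx : ∀ z : F (k + 1), (algebraMap R S x) • z = x • z := fun z => algebraMap_smul S x z
  have hx' : ∀ z : F k, (algebraMap R S x) • z = x • z := fun z => algebraMap_smul S x z
  have Tt : ∀ z, T (t • z) = t • T z := by
    intro z
    simp only [T, smul_add, smul_sub]
    have e1 : L (θ (t • t • z)) = x • L (θ (t • z)) := by
      rw [smul_smul t t z, ht, mul_smul, hx', LinearMap.map_smul θ x, LinearMap.map_smul L x]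
    have e2 : t • t • L (θ z) = t • x • L (θ z) := by
      rw [smul_smul t t (L (θ z)), ht, mul_smul, hx, smul_comm t x (L (θ z))]
    rw [e1, e2]
    abel
  have TS : ∀ (s : S) z, T (s • z) = s • T z := by
    intro s z
    rw [hs s, add_smul, add_smul, mul_smul, mul_smul, Tadd]
    rw [algebraMap_smul S (α s) z, algebraMap_smul S (β s) (t • z), TR, TR, Tt,
      algebraMap_smul, algebraMap_smul]
  refine ⟨{ toFun := T, map_add' := Tadd, map_smul' := TS }, fun y => ?_⟩
  change d k (T (d k y)) = d k y
  have : T (d k y) = τ y := by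
    simp only [T]
    rw [← map_smul (d k), hθ, hθ, map_smul τ, hL]
  rw [this, hdτ]

theorem FP.to_ext.{w, v} {R S : Type v} [CommRing R] [CommRing S] [Algebra R S]
    (t : S) (x : R) (α β : S →ₗ[R] R)
    (ht : t * t = algebraMap R S x * t)
    (hs : ∀ s, s = algebraMap R S (α s) + algebraMap R S (β s) * t)
    (hβ : ∀ s, β (t * s) = α s + x * β s)
    (b : Module.Basis (Fin 2) R S) {n : ℕ} (H : ∀ m, FP.{w, v} R n m) (m : ℕ) :
    FP.{w, v} S n m := by
  intro B d hd hm
  have hR : ∀ k, n ≤ k → Retr (F := fun i => B i →₀ S) (fun i => (d i).restrictScalars R) k := by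
    intro k hk
    have hfree : ∀ i, Module.Projective R (B i →₀ S) := fun i =>
      Module.Projective.of_basis (b.smulTower (Finsupp.basisSingleOne (R := S) (ι := B i)))
    refine Retr.le (F := fun i => B i →₀ S) (d := fun i => (d i).restrictScalars R) hd hk ?_
    refine FP.of_free (H m) (F := fun i => B i →₀ S) (fun i => Fin 2 × B i)
      (fun i => b.smulTower (Finsupp.basisSingleOne (R := S) (ι := B i))) _ hd ?_
    obtain ⟨h, hh⟩ := hm
    exact ⟨h.restrictScalars R, hh⟩
  have hdown : ∀ j, Retr (F := fun i => B i →₀ S) d (n + j) →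
      Retr (F := fun i => B i →₀ S) d n := by
    intro j
    induction j with
    | zero => exact id
    | succ j ih =>
      intro h
      refine ih (down_step (F := fun i => B i →₀ S) t x α β ht hs d hd (n + j)
        (Finsupp.mapRange.linearMap (Algebra.linearMap R S ∘ₗ β)) ?_ h (hR _ (by omega)))
      intro y
      ext c
      change t * algebraMap R S (β (y c)) + algebraMap R S (β (t * y c)) -
        x • algebraMap R S (β (y c)) = y c
      rw [hβ, map_add, map_mul, Algebra.smul_def]
      conv_rhs => rw [hs (y c)]
      ring
  rcases le_total m n with h | h
  · exact Retr.le (F := fun i => B i →₀ S) hd h hm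
  · obtain ⟨j, rfl⟩ := Nat.exists_eq_add_of_le h
    exact hdown j hm

open TensorProduct in
theorem FP.of_ext.{w, v} {R S : Type v} [CommRing R] [CommRing S] [Algebra R S]
    (α : S →ₗ[R] R) (hα : α 1 = 1) [Module.Flat R S] {n m : ℕ} (H : FP.{w, v} S n m) :
    FP.{w, v} R n m := by
  intro B d hd ⟨k, hk⟩
  have := FP.of_free H (F := fun i => S ⊗[R] (B i →₀ R)) B
    (fun i => (Finsupp.basisSingleOne (R := R) (ι := B i)).baseChange S)
    (fun i => (d i).baseChange S) (fun i => Module.Flat.lTensor_exact S (hd i))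
    ⟨k.baseChange S, fun y => by
      have e : d m ∘ₗ k ∘ₗ d m = d m := LinearMap.ext hk
      have e' := congrArg (fun f => LinearMap.baseChange S f) e
      simp only [LinearMap.baseChange_comp] at e'
      exact LinearMap.congr_fun e' y⟩
  obtain ⟨h, hh⟩ := this
  let p : ∀ i, S ⊗[R] (B i →₀ R) →ₗ[R] (B i →₀ R) := fun i =>
    (TensorProduct.lid R _).toLinearMap ∘ₗ LinearMap.rTensor _ α
  have hp : ∀ i y, d i (p (i + 1) y) = p i ((d i).baseChange S y) := by
    intro i y
    induction y with
    | zero => simp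
    | add a b ha hb => simp only [map_add, ha, hb]
    | tmul s y => simp [p]
  refine ⟨p (n + 1) ∘ₗ h.restrictScalars R ∘ₗ TensorProduct.mk R S _ 1, fun y => ?_⟩
  have e := hh (1 ⊗ₜ y)
  simp only [LinearMap.baseChange_tmul] at e
  simp only [LinearMap.comp_apply, LinearMap.coe_restrictScalars, TensorProduct.mk_apply, hp, e]
  simp [p, hα]

end transfer

theorem amalg_FP_iff.{v} (R : Type v) [CommRing R] (x : R) (hx : x ∈ nonZeroDivisors R) (n : ℕ) :
    (∀ m, FP.{v, v} (amalg R (Ideal.span {x})) n m) ↔ ∀ m, FP.{v, v} R n m := by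
  let S := amalg R (Ideal.span {x})
  let t : S := gx R x
  let f : (R × R) →ₗ[R] S :=
    { toFun := fun p => algebraMap R S p.1 + algebraMap R S p.2 * t
      map_add' := fun p q => by simp only [Prod.fst_add, Prod.snd_add, map_add]; ring
      map_smul' := fun r p => by
        simp only [Prod.smul_fst, Prod.smul_snd, smul_eq_mul, map_mul, RingHom.id_apply]
        rw [Algebra.smul_def]; ring }
  have f1 : ∀ p, ((f p : S) : R × R) = (p.1, p.1 + p.2 * x) := by
    intro p
    ext
    · change p.1 + p.2 * 0 = p.1
      ring
    · rfl
  have hinj : Function.Injective f := by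
    intro p q h
    have h' := congrArg Subtype.val h
    rw [f1, f1, Prod.mk.injEq] at h'
    obtain ⟨h1, h2⟩ := h'
    rw [h1, add_right_inj] at h2
    exact Prod.ext h1 ((mul_cancel_right_mem_nonZeroDivisors hx).1 h2)
  have hsurj : Function.Surjective f := by
    rintro ⟨_, r, e, he, rfl⟩
    obtain ⟨c, rfl⟩ := Ideal.mem_span_singleton'.1 he
    exact ⟨(r, c), Subtype.ext (f1 _)⟩
  let E : (R × R) ≃ₗ[R] S := LinearEquiv.ofBijective f ⟨hinj, hsurj⟩
  have hE : ∀ p, E p = algebraMap R S p.1 + algebraMap R S p.2 * t := fun p => rfl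
  let α : S →ₗ[R] R := LinearMap.fst R R R ∘ₗ E.symm.toLinearMap
  let β : S →ₗ[R] R := LinearMap.snd R R R ∘ₗ E.symm.toLinearMap
  have hs : ∀ s, s = algebraMap R S (α s) + algebraMap R S (β s) * t := fun s =>
    (E.apply_symm_apply s).symm
  have ht : t * t = algebraMap R S x * t := by
    apply Subtype.ext
    ext
    · change (0 : R) * 0 = x * 0
      ring
    · rfl
  have hβ : ∀ s, β (t * s) = α s + x * β s := by
    intro s
    have : t * s = E (0, α s + x * β s) := by
      rw [hE]
      conv_lhs => rw [hs s]
      simp only [map_zero, map_add, map_mul]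
      linear_combination algebraMap R S (β s) * ht
    rw [this]
    simp [β]
  have hα : α 1 = 1 := by
    have : (1 : S) = E (1, 0) := by simp [hE]
    rw [this]
    simp [α]
  let b : Module.Basis (Fin 2) R S := (Module.Basis.finTwoProd R).map E
  have : Module.Free R S := Module.Free.of_basis b
  constructor
  · intro H m
    exact FP.of_ext α hα (H m)
  · intro H m
    exact FP.to_ext t x α β ht hs hβ b H m

/-- for x regular, FPD(R⋈xR) = FPD(R): for each n, every module of finite
projective dimension has projective dimension ≤ n over R⋈xR iff the same holds over R
(projective dimension expressed by Ext-vanishing). -/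
theorem fpd_amalg_eq (R : Type u) [CommRing R] (x : R) (hx : x ∈ nonZeroDivisors R) :
    ∀ n : ℕ,
      (∀ M : ModuleCat (amalg R (Ideal.span {x})),
        (∃ m : ℕ, ∀ N : ModuleCat (amalg R (Ideal.span {x})),
          Subsingleton (((Ext (amalg R (Ideal.span {x}))
              (ModuleCat (amalg R (Ideal.span {x}))) (m + 1)).obj
            (Opposite.op M)).obj N)) →
        (∀ N : ModuleCat (amalg R (Ideal.span {x})),
          Subsingleton (((Ext (amalg R (Ideal.span {x}))
              (ModuleCat (amalg R (Ideal.span {x}))) (n + 1)).obj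
            (Opposite.op M)).obj N))) ↔
      (∀ M : ModuleCat R,
        (∃ m : ℕ, ∀ N : ModuleCat R,
          Subsingleton (((Ext R (ModuleCat R) (m + 1)).obj (Opposite.op M)).obj N)) →
        (∀ N : ModuleCat R,
          Subsingleton (((Ext R (ModuleCat R) (n + 1)).obj (Opposite.op M)).obj N))) := by
  intro n
  refine (fpd_iff_FP (amalg R (Ideal.span {x})) n).trans (Iff.trans ?_ (fpd_iff_FP R n).symm)
  exact ⟨fun H m => FP.up ((amalg_FP_iff R x hx n).1 (fun m => FP.down (H m)) m),
    fun H m => FP.up ((amalg_FP_iff R x hx n).2 (fun m => FP.down (H m)) m)⟩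
end

section
/- Let R be a commutative ring containing a regular element x. Then the global cotorsion dimension of R⋈xR equals that of R. (The cotorsion dimension of a module M over S is the least n with Ext^{n+1}_S(F, M) = 0 for all flat S-modules F; the global cotorsion dimension of S is the supremum over all S-modules, and it is ≤ n iff every flat S-module has projective dimension ≤ n.) -/
open CategoryTheory

set_option synthInstance.maxHeartbeats 1000000

section Helpers

universe u v w

lemma flat_ker {R : Type*} [CommRing R] {P F : Type*} [AddCommGroup P] [AddCommGroup F]
    [Module R P] [Module R F] [Module.Flat R P] [Module.Flat R F] (f : P →ₗ[R] F)
    (hf : Function.Surjective f) : Module.Flat R (LinearMap.ker f) := by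
  rw [Module.Flat.iff_rTensor_preserves_injective_linearMap]
  intro A B _ _ _ _ i hi
  have h1 := LinearMap.lTensor_injective_of_exact_of_flat f hf _
    (LinearMap.ker f).subtype_injective (LinearMap.exact_subtype_ker_map _) A
  have h2 := Module.Flat.rTensor_preserves_injective_linearMap (M := P) i hi
  have h3 : (i.rTensor P) ∘ₗ ((LinearMap.ker f).subtype.lTensor A) =
      ((LinearMap.ker f).subtype.lTensor B) ∘ₗ (i.rTensor (LinearMap.ker f)) := by
    rw [LinearMap.rTensor_comp_lTensor, LinearMap.lTensor_comp_rTensor]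
  have h4 : Function.Injective (((LinearMap.ker f).subtype.lTensor B) ∘ₗ 
      (i.rTensor (LinearMap.ker f))) := by
    rw [← h3]
    exact h2.comp h1
  exact Function.Injective.of_comp h4

lemma small_span_range {R : Type u} [CommRing R] {G : Type w} [AddCommGroup G] [Module R G]
    {T : Type*} [Small.{u} T] (f : T → G) : Small.{u} (Submodule.span R (Set.range f)) := by
  have h : Submodule.span R (Set.range f) =
      LinearMap.range (Finsupp.linearCombination R (f ∘ (equivShrink.{u} T).symm)) := by
    rw [Finsupp.range_linearCombination, Set.range_comp, Equiv.range_eq_univ, Set.image_univ]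
  rw [h]
  exact small_of_surjective (LinearMap.surjective_rangeRestrict _)

lemma closure_step {R : Type u} [CommRing R] {G : Type w} [AddCommGroup G] [Module R G]
    (N : Submodule R G) [Small.{u} N] : ∃ N' : Submodule R G, Small.{u} N' ∧
      ∀ (l : ℕ) (r : Fin l → R) (x : Fin l → G), ∑ i, r i • x i ∈ N →
        ∃ x' : Fin l → G, (∀ i, x' i ∈ N') ∧ ∑ i, r i • x' i = ∑ i, r i • x i := by
  classical
  let T := (l : ℕ) × ((Fin l → R) × N × Fin l)
  let f : T → G := fun t => if h : ∃ x : Fin t.1 → G, ∑ i, t.2.1 i • x i = t.2.2.1 then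
    h.choose t.2.2.2 else 0
  refine ⟨Submodule.span R (Set.range f), small_span_range f, fun l r x hx => ?_⟩
  have h : ∃ x' : Fin l → G, ∑ i, r i • x' i = (⟨_, hx⟩ : N) := ⟨x, rfl⟩
  refine ⟨h.choose, fun i => Submodule.subset_span ⟨⟨l, r, ⟨_, hx⟩, i⟩, ?_⟩, h.choose_spec⟩
  simp only [f]
  rw [dif_pos h]

lemma trivial_map {R : Type*} [CommRing R] {G H : Type*} [AddCommGroup G] [Module R G]
    [AddCommGroup H] [Module R H] (q : G →ₗ[R] H) {l : ℕ} {r : Fin l → R} {x : Fin l → G}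
    (h : Module.IsTrivialRelation r x) : Module.IsTrivialRelation r (fun i => q (x i)) := by
  obtain ⟨k, a, y, h1, h2⟩ := h
  exact ⟨k, a, fun j => q (y j), fun i => by simp [h1], h2⟩

lemma exists_small_pure {R : Type u} [CommRing R] {G : Type w} [AddCommGroup G] [Module R G]
    [Module.Flat R G] (y : G) : ∃ N : Submodule R G, Small.{u} N ∧ y ∈ N ∧
      Module.Flat R (G ⧸ N) := by
  choose! c hc1 hc2 using fun (N : Submodule R G) (h : Small.{u} N) => closure_step N
  let S : ℕ → Submodule R G := fun k => c^[k] (Submodule.span R {y})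
  have hS : ∀ k, S (k+1) = c (S k) := fun k => Function.iterate_succ_apply' _ _ _
  have hsm : ∀ k, Small.{u} (S k) := by
    intro k
    induction k with
    | zero =>
      have := small_span_range (R := R) (fun _ : Unit => y)
      simpa [S] using this
    | succ k ih => rw [hS]; exact hc1 _ ih
  have hmono : Monotone S := by
    refine monotone_nat_of_le_succ fun k g hg => ?_
    obtain ⟨x', hx', h⟩ := hc2 (S k) (hsm k) 1 (fun _ => 1) (fun _ => g) (by simpa using hg)
    rw [hS]
    simp only [Finset.univ_unique, one_smul, Finset.sum_singleton] at h
    exact h ▸ hx' _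
  have hmem : ∀ z, z ∈ (⨆ k, S k) ↔ ∃ k, z ∈ S k := fun z =>
    Submodule.mem_iSup_of_directed S hmono.directed_le
  refine ⟨⨆ k, S k, ?_, (hmem y).2 ⟨0, Submodule.mem_span_singleton_self y⟩, ?_⟩
  · let f : ((k : ℕ) × S k) → (⨆ k, S k : Submodule R G) := fun t =>
      ⟨t.2.1, (hmem _).2 ⟨t.1, t.2.2⟩⟩
    have hf : Function.Surjective f := by
      rintro ⟨z, hz⟩
      obtain ⟨k, hk⟩ := (hmem z).1 hz
      exact ⟨⟨k, z, hk⟩, rfl⟩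
    exact small_of_surjective hf
  · refine Module.Flat.of_forall_isTrivialRelation fun {l r x} h => ?_
    obtain ⟨x, rfl⟩ : ∃ x' : Fin l → G, (fun i => (⨆ k, S k).mkQ (x' i)) = x := by
      choose x' hx' using fun i => (⨆ k, S k).mkQ_surjective (x i)
      exact ⟨x', funext hx'⟩
    simp only [← map_smul, ← map_sum] at h
    rw [Submodule.mkQ_apply, Submodule.Quotient.mk_eq_zero] at h
    obtain ⟨k, hk⟩ := (hmem _).1 h
    obtain ⟨x', hx', he⟩ := hc2 (S k) (hsm k) l r x hk
    have h0 : ∑ i, r i • (x i - x' i) = 0 := by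
      simp only [smul_sub, Finset.sum_sub_distrib, he, sub_self]
    have := trivial_map (⨆ k, S k).mkQ (Module.Flat.isTrivialRelation_of_sum_smul_eq_zero h0)
    convert this using 2 with i
    rw [map_sub, eq_comm, sub_eq_self, Submodule.mkQ_apply, Submodule.Quotient.mk_eq_zero, hmem]
    exact ⟨k+1, by rw [hS]; exact hx' i⟩

lemma flat_quot_sSup {R : Type*} [CommRing R] {F : Type*} [AddCommGroup F] [Module R F]
    (c : Set (Submodule R F)) (hne : c.Nonempty) (hdir : DirectedOn (· ≤ ·) c)
    (hc : ∀ N ∈ c, Module.Flat R (F ⧸ N)) : Module.Flat R (F ⧸ sSup c) := by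
  refine Module.Flat.of_forall_isTrivialRelation fun {l r x} h => ?_
  obtain ⟨x, rfl⟩ : ∃ x' : Fin l → F, (fun i => (sSup c).mkQ (x' i)) = x := by
    choose x' hx' using fun i => (sSup c).mkQ_surjective (x i)
    exact ⟨x', funext hx'⟩
  simp only [← map_smul, ← map_sum] at h
  rw [Submodule.mkQ_apply, Submodule.Quotient.mk_eq_zero, 
    Submodule.mem_sSup_of_directed hne hdir] at h
  obtain ⟨N, hN, hm⟩ := h
  have := hc N hN
  have h0 : ∑ i, r i • N.mkQ (x i) = 0 := by
    simp only [← map_smul, ← map_sum]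
    rwa [Submodule.mkQ_apply, Submodule.Quotient.mk_eq_zero]
  exact trivial_map (Submodule.factor (le_sSup hN)) 
    (Module.Flat.isTrivialRelation_of_sum_smul_eq_zero h0)

lemma eklof {R : Type u} [CommRing R] {F A B : Type w} [AddCommGroup F] [Module R F]
    [AddCommGroup A] [Module R A] [AddCommGroup B] [Module R B] [Module.Flat R F]
    [Module.Injective R A] (q : A →ₗ[R] B)
    (h : ∀ (G : Type w) [AddCommGroup G] [Module R G] [Module.Flat R G] [Small.{u} G]
      (g : G →ₗ[R] B), ∃ t : G →ₗ[R] A, q ∘ₗ t = g) (f : F →ₗ[R] B) :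
    ∃ t : F →ₗ[R] A, q ∘ₗ t = f := by
  let Z : Set (F →ₗ.[R] A) := {s | Module.Flat R (F ⧸ s.domain) ∧ ∀ x, q (s x) = f x}
  obtain ⟨s, hs⟩ : ∃ s, Maximal (· ∈ Z) s := by
    refine zorn_le₀ Z fun c hcZ hc => ?_
    rcases c.eq_empty_or_nonempty with rfl | hne
    · refine ⟨⊥, ⟨?_, ?_⟩, by simp⟩
      · exact Module.Flat.of_linearEquiv (Submodule.quotEquivOfEqBot _ rfl)
      · rintro ⟨x, hx⟩
        obtain rfl : x = 0 := hx
        exact ((congrArg q (LinearPMap.map_zero _)).trans (map_zero q)).trans (map_zero f).symm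
    · refine ⟨LinearPMap.sSup c hc.directedOn, ⟨?_, ?_⟩, fun s hs => LinearPMap.le_sSup _ hs⟩
      · rw [LinearPMap.domain_sSup]
        refine flat_quot_sSup _ (hne.image _) 
          (DirectedOn.mono_comp LinearPMap.domain_mono.monotone hc.directedOn) ?_
        rintro _ ⟨s, hs, rfl⟩
        exact (hcZ hs).1
      · rintro ⟨x, hx⟩
        obtain ⟨s, hs, hxs⟩ := (LinearPMap.mem_domain_sSup_iff hne hc.directedOn).1 hx
        rw [← (hcZ hs).2 ⟨x, hxs⟩]
        congr 1
        exact ((LinearPMap.le_sSup hc.directedOn hs).2 rfl).symm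
  obtain ⟨hflat, hlift⟩ := hs.prop
  obtain ⟨e, he⟩ := Module.Injective.out s.domain.subtype s.domain.subtype_injective s.toFun
  let D := s.domain
  have hD : D ≤ LinearMap.ker (f - q ∘ₗ e) := by
    intro x hx
    rw [LinearMap.mem_ker, LinearMap.sub_apply, LinearMap.comp_apply, sub_eq_zero]
    have := he ⟨x, hx⟩
    rw [← hlift ⟨x, hx⟩]
    exact congrArg q this.symm
  have htop : ∀ y, y ∈ D := by
    intro y
    have : Module.Flat R (F ⧸ D) := hflat
    obtain ⟨N, hN1, hN2, hN3⟩ := exists_small_pure.{u} (R := R) (D.mkQ y)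
    have hNflat : Module.Flat R N := by
      have := flat_ker N.mkQ N.mkQ_surjective
      rwa [N.ker_mkQ] at this
    obtain ⟨t, ht⟩ := h N (D.liftQ _ hD ∘ₗ N.subtype)
    obtain ⟨t', ht'⟩ := Module.Injective.out N.subtype N.subtype_injective t
    let m : F →ₗ[R] A := e + t' ∘ₗ D.mkQ
    let K := LinearMap.ker (N.mkQ ∘ₗ D.mkQ)
    have hK : ∀ x, x ∈ K ↔ D.mkQ x ∈ N := fun x => by
      rw [LinearMap.mem_ker, LinearMap.comp_apply, N.mkQ_apply, Submodule.Quotient.mk_eq_zero]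
    let s' : F →ₗ.[R] A := ⟨K, m ∘ₗ K.subtype⟩
    have hs' : s' ∈ Z := by
      refine ⟨?_, ?_⟩
      · exact Module.Flat.of_linearEquiv ((N.mkQ ∘ₗ D.mkQ).quotKerEquivOfSurjective 
          (N.mkQ_surjective.comp D.mkQ_surjective))
      · rintro ⟨x, hx⟩
        have h1 := LinearMap.congr_fun ht ⟨_, (hK x).1 hx⟩
        have h2 := ht' ⟨_, (hK x).1 hx⟩
        change q (e x + t' (D.mkQ x)) = f x
        change t' (D.mkQ x) = _ at h2
        change q _ = f x - q (e x) at h1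
        rw [map_add, h2, h1]; abel
    have hle : s ≤ s' := by
      refine ⟨fun x hx => (hK x).2 ?_, ?_⟩
      · have : D.mkQ x = 0 := by simpa using hx
        rw [this]; exact N.zero_mem
      · rintro ⟨x, hx⟩ ⟨x', hx'⟩ (rfl : x = x')
        have : D.mkQ x = 0 := by simpa using hx
        change _ = e x + t' (D.mkQ x)
        rw [this, map_zero, add_zero]
        exact (he ⟨x, hx⟩).symm
    exact (hs.le_of_ge hs' hle).1 ((hK y).2 hN2)
  refine ⟨e, ?_⟩
  ext x
  have := hD (htop x)
  rw [LinearMap.mem_ker, LinearMap.sub_apply, sub_eq_zero] at this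
  exact this.symm

lemma inj_pres {R : Type u} [CommRing R] [Small.{w} R] (N : ModuleCat.{w} R) :
    ∃ (I Q : ModuleCat.{w} R) (f : N ⟶ I) (g : I ⟶ Q) (w : f ≫ g = 0), Injective I ∧
      (ShortComplex.mk f g w).ShortExact := by
  obtain ⟨I, _, f, _⟩ := EnoughInjectives.presentation N
  have injf : Function.Injective f.hom := (ModuleCat.mono_iff_injective f).mp ‹_›
  let S : ShortComplex (ModuleCat.{w} R) :=
    ModuleCat.shortComplexOfCompEqZero _ _ f.hom.exact_map_mkQ_range.linearMap_comp_eq_zero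
  have exactS : S.ShortExact := ModuleCat.shortComplex_shortExact S
    f.hom.exact_map_mkQ_range injf (Submodule.mkQ_surjective _)
  exact ⟨I, S.X₃, f, S.g, S.zero, ‹_›, exactS⟩

lemma ext_lift {R : Type u} [CommRing R] [Small.{w} R] (n : ℕ) (N : ModuleCat.{w} R)
    (h : ∀ (G : ModuleCat.{w} R), Module.Flat R G → Small.{u} G →
      Subsingleton (Abelian.Ext.{w} G N (n+1)))
    (F : ModuleCat.{w} R) (hF : Module.Flat R F) : Subsingleton (Abelian.Ext.{w} F N (n+1)) := by
  induction n generalizing N F with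
  | zero =>
    obtain ⟨I, Q, f, g, w, hI, exactS⟩ := inj_pres N
    refine subsingleton_of_forall_eq 0 fun α => ?_
    obtain ⟨β, rfl⟩ := Abelian.Ext.covariant_sequence_exact₁ F exactS α
      (Abelian.Ext.eq_zero_of_injective _) (zero_add 1)
    obtain ⟨φ, rfl⟩ := Abelian.Ext.homEquiv₀.symm.surjective β
    have : Module.Injective R I := Module.injective_module_of_injective_object R I
    obtain ⟨t, ht⟩ := eklof (A := I) (B := Q) g.hom (fun G _ _ _ _ g' => by
      have := h (ModuleCat.of R G) inferInstance inferInstance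
      obtain ⟨φ, hφ⟩ := Abelian.Ext.covariant_sequence_exact₃ (ModuleCat.of R G) exactS
        (Abelian.Ext.mk₀ (ModuleCat.ofHom g')) (zero_add 1) (Subsingleton.elim _ _)
      obtain ⟨φ, rfl⟩ := Abelian.Ext.homEquiv₀.symm.surjective φ
      have h1 : φ ≫ g = ModuleCat.ofHom g' :=
        Abelian.Ext.homEquiv₀.symm.injective (by simpa using hφ)
      exact ⟨φ.hom, congrArg ModuleCat.Hom.hom h1⟩) φ.hom
    have h2 : φ = ModuleCat.ofHom t ≫ g := by
      ext1; exact ht.symm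
    have h3 := exactS.comp_extClass
    dsimp only at h3
    rw [h2, Abelian.Ext.homEquiv₀_symm_apply, ← Abelian.Ext.mk₀_comp_mk₀]
    rw [Abelian.Ext.comp_assoc _ _ _ (zero_add 0) (zero_add 1) (by simp), h3,
      Abelian.Ext.comp_zero]
  | succ n ih =>
    obtain ⟨I, Q, f, g, w, hI, exactS⟩ := inj_pres N
    have key := ih Q (fun G hG hs => by
      have := h G hG hs
      refine subsingleton_of_forall_eq 0 fun α => ?_
      obtain ⟨β, rfl⟩ := Abelian.Ext.covariant_sequence_exact₃ G exactS α rfl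
        (Subsingleton.elim _ _)
      have hβ : β = 0 := Abelian.Ext.eq_zero_of_injective (I := I) β
      rw [hβ, Abelian.Ext.zero_comp]) F hF
    refine subsingleton_of_forall_eq 0 fun α => ?_
    obtain ⟨β, rfl⟩ := Abelian.Ext.covariant_sequence_exact₁ F exactS α
      (Abelian.Ext.eq_zero_of_injective (I := I) _) rfl
    rw [Subsingleton.elim β 0, Abelian.Ext.zero_comp]

def GD (R : Type u) [CommRing R] (n : ℕ) : Prop :=
  ∀ F : ModuleCat.{w} R, Module.Flat R F → HasProjectiveDimensionLE F n

lemma GD_up (R : Type u) [CommRing R] (n : ℕ) (h : GD.{u, u} R n) [Small.{w} R] :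
    GD.{u, w} R n := by
  intro F hF
  refine hasProjectiveDimensionLT_of_enoughInjectives F (n+1) fun N => ?_
  refine ext_lift n N (fun G hG hs => ?_) F hF
  let e : (ModuleCat.of R (Shrink.{u} G)) ≃ₗ[R] G := Shrink.linearEquiv R G
  have := h (ModuleCat.of R (Shrink.{u} G)) (Module.Flat.of_linearEquiv e)
  have : HasProjectiveDimensionLE G n := ModuleCat.hasProjectiveDimensionLE_of_linearEquiv.{u, w} e n
  exact HasProjectiveDimensionLT.subsingleton G (n+1) (n+1) le_rfl N

lemma GD_down (R : Type u) [CommRing R] (n : ℕ) (h : GD.{u, max u v} R n) :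
    GD.{u, u} R n := by
  intro F hF
  let e : (ModuleCat.of R (ULift.{v} F)) ≃ₗ[R] F := ULift.moduleEquiv
  have := h (ModuleCat.of R (ULift.{v} F)) (Module.Flat.of_linearEquiv e)
  exact ModuleCat.hasProjectiveDimensionLE_of_linearEquiv.{max u v, u} e n

lemma ext_subsingleton_iff {R : Type u} [CommRing R] [Small.{w} R] 
    (F : ModuleCat.{w} R) (M : ModuleCat.{w} R) (n : ℕ) :
    Subsingleton (((Ext R (ModuleCat.{w} R) (n + 1)).obj (Opposite.op F)).obj M) ↔
      Subsingleton (Abelian.Ext.{w} F M (n + 1)) := by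
  let P := ProjectiveResolution.of F
  rw [← ModuleCat.isZero_iff_subsingleton, (P.isoExt (R := R) (n+1) M).isZero_iff,
    ← HomologicalComplex.exactAt_iff_isZero_homology,
    HomologicalComplex.exactAt_iff' _ n (n+1) (n+2) (by simp) (by simp),
    ShortComplex.moduleCat_exact_iff]
  constructor
  · intro h
    refine subsingleton_of_forall_eq 0 fun α => ?_
    obtain ⟨f, hf, rfl⟩ := P.extMk_surjective α (n+2) rfl
    rw [P.extMk_eq_zero_iff _ _ _ _ n rfl]
    exact h f hf
  · intro h f hf
    exact (P.extMk_eq_zero_iff f (n+2) rfl hf n rfl).1 (Subsingleton.elim _ _)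

lemma bridge {R : Type u} [CommRing R] [Small.{w} R] 
    (F : ModuleCat.{w} R) (n : ℕ) :
    (∀ M : ModuleCat.{w} R, Subsingleton (((Ext R (ModuleCat.{w} R) (n + 1)).obj (Opposite.op F)).obj M)) ↔
      HasProjectiveDimensionLE F n := by
  simp only [ext_subsingleton_iff]
  constructor
  · exact hasProjectiveDimensionLT_of_enoughInjectives F (n+1) 
  · intro h M
    exact HasProjectiveDimensionLT.subsingleton F (n+1) (n+1) le_rfl M

open TensorProduct

lemma pd_succ_iff {R : Type u} [CommRing R] {K P X : Type u} [AddCommGroup K] [AddCommGroup P]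
    [AddCommGroup X] [Module R K] [Module R P] [Module R X] [Module.Projective R P]
    (i : K →ₗ[R] P) (f : P →ₗ[R] X) (hi : Function.Injective i) (hf : Function.Surjective f)
    (hif : Function.Exact i f) (n : ℕ) :
    HasProjectiveDimensionLE (ModuleCat.of R X) (n+1) ↔
      HasProjectiveDimensionLE (ModuleCat.of R K) n := by
  let S : ShortComplex (ModuleCat.{u} R) :=
    ModuleCat.shortComplexOfCompEqZero i f hif.linearMap_comp_eq_zero
  have exactS : S.ShortExact := ModuleCat.shortComplex_shortExact S hif hi hf
  have hP : Projective S.X₂ := (IsProjective.iff_projective P).1 ‹_›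
  exact exactS.hasProjectiveDimensionLT_X₃_iff n hP

lemma pd_zero_iff {R : Type u} [CommRing R] {X : Type u} [AddCommGroup X] [Module R X] :
    HasProjectiveDimensionLE (ModuleCat.of R X) 0 ↔ Module.Projective R X := by
  rw [IsProjective.iff_projective, projective_iff_hasProjectiveDimensionLE_zero]

lemma exists_pres (S : Type u) [CommRing S] (K : Type u) [AddCommGroup K] [Module S K] :
    ∃ (P L : Type u) (_ : AddCommGroup P) (_ : AddCommGroup L) (_ : Module S P) (_ : Module S L)
      (i : L →ₗ[S] P) (f : P →ₗ[S] K), Module.Free S P ∧ Function.Injective i ∧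
        Function.Surjective f ∧ Function.Exact i f := by
  have key : ∀ (P : Type u) [AddCommGroup P] [Module S P] (f : P →ₗ[S] K), Module.Free S P →
      Function.Surjective f →
      ∃ (P L : Type u) (_ : AddCommGroup P) (_ : AddCommGroup L) (_ : Module S P) (_ : Module S L)
      (i : L →ₗ[S] P) (f : P →ₗ[S] K), Module.Free S P ∧ Function.Injective i ∧
        Function.Surjective f ∧ Function.Exact i f := fun P _ _ f h1 h2 =>
    ⟨P, LinearMap.ker f, inferInstance, inferInstance, inferInstance, inferInstance,
      (LinearMap.ker f).subtype, f, h1, (LinearMap.ker f).subtype_injective, h2,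
      LinearMap.exact_subtype_ker_map f⟩
  exact key (K →₀ S) (Finsupp.linearCombination S id) inferInstance
    (Finsupp.linearCombination_id_surjective S K)

lemma flat_ker_exact {S : Type u} [CommRing S] {L P K : Type u} [AddCommGroup L] [AddCommGroup P]
    [AddCommGroup K] [Module S L] [Module S P] [Module S K] [Module.Flat S K] [Module.Flat S P]
    (i : L →ₗ[S] P) (f : P →ₗ[S] K) (hi : Function.Injective i) (hf : Function.Surjective f)
    (hif : Function.Exact i f) : Module.Flat S L := by
  have := flat_ker f hf
  have e : L ≃ₗ[S] LinearMap.ker f :=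
    (LinearEquiv.ofInjective i hi).trans (LinearEquiv.ofEq _ _ hif.linearMap_ker_eq.symm)
  exact Module.Flat.of_linearEquiv e

lemma pd_restrict {R S : Type u} [CommRing R] [CommRing S] [Algebra R S] [Module.Free R S]
    (n : ℕ) (X : Type u) [AddCommGroup X] [Module R X] [Module S X] [IsScalarTower R S X]
    (h : HasProjectiveDimensionLE (ModuleCat.of S X) n) :
    HasProjectiveDimensionLE (ModuleCat.of R X) n := by
  induction n generalizing X with
  | zero =>
    rw [pd_zero_iff] at h ⊢
    have hf : Function.Surjective (Finsupp.linearCombination S (id : X → X)) :=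
      Finsupp.linearCombination_id_surjective S X
    obtain ⟨s, hs⟩ := Module.projective_lifting_property _ LinearMap.id hf
    exact Module.Projective.of_split (s.restrictScalars R)
      ((Finsupp.linearCombination S (id : X → X)).restrictScalars R)
      (by ext x; exact LinearMap.congr_fun hs x)
  | succ n ih =>
    obtain ⟨P, L, _, _, _, _, i, f, hP, hi, hf, hif⟩ := exists_pres S X
    let _ : Module R P := Module.compHom P (algebraMap R S)
    let _ : Module R L := Module.compHom L (algebraMap R S)
    have : IsScalarTower R S P := IsScalarTower.of_algebraMap_smul fun _ _ => rfl
    have : IsScalarTower R S L := IsScalarTower.of_algebraMap_smul fun _ _ => rfl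
    have : Module.Free R P := Module.Free.trans (R := R) (S := S)
    have h' := (pd_succ_iff i f hi hf hif n).1 h
    exact (pd_succ_iff (i.restrictScalars R) (f.restrictScalars R) hi hf hif n).2 (ih L h')

lemma GD_of_retract {R S : Type u} [CommRing R] [CommRing S] [Algebra R S] [Module.Free R S]
    (ε : S →ₐ[R] R) (n : ℕ) (h : GD.{u, u} S n) : GD.{u, u} R n := by
  intro F hF
  have h1 := pd_restrict (R := R) n (S ⊗[R] F) (h (ModuleCat.of S (S ⊗[R] F)) inferInstance)
  let r : Retract F (ModuleCat.of R (S ⊗[R] F)) :=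
    { i := ModuleCat.ofHom (TensorProduct.mk R S F 1)
      r := ModuleCat.ofHom ((TensorProduct.lid R F).toLinearMap ∘ₗ ε.toLinearMap.rTensor F)
      retract := by
        ext x
        simp }
  exact r.hasProjectiveDimensionLT (n+1)

/-- extension of maps into modules killed by the kernel. -/
lemma extend_killed {S A : Type u} [CommRing S] [CommRing A] [Algebra S A]
    (hA : Function.Surjective (algebraMap S A))
    {L P K N : Type u} [AddCommGroup L] [AddCommGroup P] [AddCommGroup K] [AddCommGroup N]
    [Module S L] [Module S P] [Module S K] [Module S N] [Module.Flat S K]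
    [Module.Projective A (A ⊗[S] K)]
    (i : L →ₗ[S] P) (f : P →ₗ[S] K) (hi : Function.Injective i) (hf : Function.Surjective f)
    (hif : Function.Exact i f)
    (hN : ∀ s : S, algebraMap S A s = 0 → ∀ x : N, s • x = 0) (h : L →ₗ[S] N) :
    ∃ g : P →ₗ[S] N, g ∘ₗ i = h := by
  have hinj : Function.Injective (i.baseChange A) :=
    LinearMap.lTensor_injective_of_exact_of_flat f hf i hi hif A
  have hsurj : Function.Surjective (f.baseChange A) := LinearMap.lTensor_surjective A hf
  have hex : Function.Exact (i.baseChange A) (f.baseChange A) := lTensor_exact A hif hf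
  obtain ⟨s, hs⟩ := Module.projective_lifting_property (f.baseChange A) LinearMap.id hsurj
  obtain ⟨ρ, hρ⟩ : ∃ ρ, ρ ∘ₗ (i.baseChange A) = LinearMap.id := by
    have t : (Function.Injective (i.baseChange A) ∧
          ∃ l, (f.baseChange A) ∘ₗ l = LinearMap.id) ↔
        (Function.Surjective (f.baseChange A) ∧ ∃ l, l ∘ₗ (i.baseChange A) = LinearMap.id) :=
      hex.split_tfae'.out 0 1
    exact (t.1 ⟨hinj, s, hs⟩).2
  let φ : A →ₗ[S] N →ₗ[S] N := (LinearMap.ker (Algebra.linearMap S A)).liftQ (LinearMap.lsmul S N)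
      (fun s hs => by ext x; exact hN s hs x) ∘ₗ
    ((Algebra.linearMap S A).quotKerEquivOfSurjective hA).symm.toLinearMap
  have hφ : φ 1 = LinearMap.id := by
    have : ((Algebra.linearMap S A).quotKerEquivOfSurjective hA).symm 1 =
        (LinearMap.ker (Algebra.linearMap S A)).mkQ 1 := by
      rw [LinearEquiv.symm_apply_eq]
      exact (map_one (algebraMap S A)).symm
    ext x
    simp only [φ, LinearMap.comp_apply, LinearEquiv.coe_coe, this]
    exact one_smul S x
  let j : A ⊗[S] N →ₗ[S] N := TensorProduct.lift φ
  refine ⟨j ∘ₗ (h.lTensor A) ∘ₗ (ρ.restrictScalars S) ∘ₗ TensorProduct.mk S A P 1, ?_⟩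
  ext x
  have h1 : ρ (1 ⊗ₜ i x) = 1 ⊗ₜ x := by
    simpa using LinearMap.congr_fun hρ (1 ⊗ₜ x)
  simp [h1, j, hφ]

lemma patch_zero {S A B : Type u} [CommRing S] [CommRing A] [Algebra S A] [CommRing B] [Algebra S B]
    (hA : Function.Surjective (algebraMap S A)) (hB : Function.Surjective (algebraMap S B))
    (hAB : ∀ a b : S, algebraMap S A a = 0 → algebraMap S B b = 0 → a * b = 0)
    (K : Type u) [AddCommGroup K] [Module S K] [Module.Flat S K]
    [Module.Projective A (A ⊗[S] K)] [Module.Projective B (B ⊗[S] K)] :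
    Module.Projective S K := by
  obtain ⟨P, L, _, _, _, _, i, f, hP, hi, hf, hex⟩ := exists_pres S K
  let I : Ideal S := RingHom.ker (algebraMap S A)
  let M : Submodule S L := I • ⊤
  obtain ⟨g, hg⟩ := extend_killed hA i f hi hf hex (N := L ⧸ M)
    (by
      intro s hs x
      obtain ⟨x, rfl⟩ := M.mkQ_surjective x
      rw [← map_smul, Submodule.mkQ_apply, Submodule.Quotient.mk_eq_zero]
      exact Submodule.smul_mem_smul hs trivial) M.mkQ
  obtain ⟨g', hg'⟩ := Module.projective_lifting_property M.mkQ g M.mkQ_surjective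
  have hM : ∀ x, (LinearMap.id - g' ∘ₗ i : L →ₗ[S] L) x ∈ M := by
    intro x
    rw [← Submodule.Quotient.mk_eq_zero, ← M.mkQ_apply]
    have h1 := LinearMap.congr_fun hg x
    have h2 := LinearMap.congr_fun hg' (i x)
    simp only [LinearMap.comp_apply] at h1 h2
    simp only [LinearMap.sub_apply, LinearMap.comp_apply, map_sub, LinearMap.id_apply]
    rw [h2, h1, sub_self]
  obtain ⟨k, hk⟩ := extend_killed hB i f hi hf hex (N := M)
    (by
      rintro s hs ⟨x, hx⟩
      ext1
      change s • x = 0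
      induction hx using Submodule.smul_induction_on' with
      | smul a ha y hy => rw [smul_smul, mul_comm, hAB a s ha hs, zero_smul]
      | add y _ z _ h1 h2 => rw [smul_add, h1, h2, add_zero])
    ((LinearMap.id - g' ∘ₗ i : L →ₗ[S] L).codRestrict M hM)
  let r : P →ₗ[S] L := g' + M.subtype ∘ₗ k
  have hr : r ∘ₗ i = LinearMap.id := by
    ext1 x
    have h1 := congrArg Subtype.val (LinearMap.congr_fun hk x)
    simp only [LinearMap.comp_apply, LinearMap.codRestrict_apply, LinearMap.sub_apply,
      LinearMap.id_apply] at h1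
    simp only [r, LinearMap.add_apply, LinearMap.comp_apply, LinearMap.id_apply]
    change _ + ((k (i x) : M) : L) = _
    rw [h1]; abel
  have t : (Function.Injective i ∧ ∃ l, f ∘ₗ l = LinearMap.id) ↔
      (Function.Surjective f ∧ ∃ l, l ∘ₗ i = LinearMap.id) := hex.split_tfae'.out 0 1
  obtain ⟨s, hs⟩ := (t.2 ⟨hf, r, hr⟩).2
  exact Module.Projective.of_split s f hs

lemma pd_baseChange {S A : Type u} [CommRing S] [CommRing A] [Algebra S A]
    {L P K : Type u} [AddCommGroup L] [AddCommGroup P] [AddCommGroup K]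
    [Module S L] [Module S P] [Module S K] [Module.Flat S K] [Module.Projective S P]
    (i : L →ₗ[S] P) (f : P →ₗ[S] K) (hi : Function.Injective i) (hf : Function.Surjective f)
    (hif : Function.Exact i f) (n : ℕ) :
    HasProjectiveDimensionLE (ModuleCat.of A (A ⊗[S] K)) (n+1) ↔
      HasProjectiveDimensionLE (ModuleCat.of A (A ⊗[S] L)) n :=
  pd_succ_iff (i.baseChange A) (f.baseChange A)
    (LinearMap.lTensor_injective_of_exact_of_flat f hf i hi hif A)
    (LinearMap.lTensor_surjective A hf) (lTensor_exact A hif hf) n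

lemma patch {S A B : Type u} [CommRing S] [CommRing A] [Algebra S A] [CommRing B] [Algebra S B]
    (hA : Function.Surjective (algebraMap S A)) (hB : Function.Surjective (algebraMap S B))
    (hAB : ∀ a b : S, algebraMap S A a = 0 → algebraMap S B b = 0 → a * b = 0) (n : ℕ)
    (K : Type u) [AddCommGroup K] [Module S K] [Module.Flat S K]
    (h1 : HasProjectiveDimensionLE (ModuleCat.of A (A ⊗[S] K)) n)
    (h2 : HasProjectiveDimensionLE (ModuleCat.of B (B ⊗[S] K)) n) :
    HasProjectiveDimensionLE (ModuleCat.of S K) n := by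
  induction n generalizing K with
  | zero =>
    rw [pd_zero_iff] at h1 h2 ⊢
    exact patch_zero hA hB hAB K
  | succ n ih =>
    obtain ⟨P, L, _, _, _, _, i, f, hP, hi, hf, hex⟩ := exists_pres S K
    have hL := flat_ker_exact i f hi hf hex
    exact (pd_succ_iff i f hi hf hex n).2 (ih L
      ((pd_baseChange i f hi hf hex n).1 h1) ((pd_baseChange i f hi hf hex n).1 h2))

lemma GD_patch {S A B : Type u} [CommRing S] [CommRing A] [Algebra S A] [CommRing B] [Algebra S B]
    (hA : Function.Surjective (algebraMap S A)) (hB : Function.Surjective (algebraMap S B))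
    (hAB : ∀ a b : S, algebraMap S A a = 0 → algebraMap S B b = 0 → a * b = 0) (n : ℕ)
    (h1 : GD.{u, u} A n) (h2 : GD.{u, u} B n) : GD.{u, u} S n := fun K _ =>
  patch hA hB hAB n K (h1 (ModuleCat.of A (A ⊗[S] K)) inferInstance)
    (h2 (ModuleCat.of B (B ⊗[S] K)) inferInstance)

lemma amalg_free {R : Type u} [CommRing R] (x : R) (hx : x ∈ nonZeroDivisors R) :
    Module.Free R (amalg R (Ideal.span {x})) := by
  let f : (R × R) →ₗ[R] amalg R (Ideal.span {x}) :=
    { toFun := fun p => ⟨(p.1, p.1 + x * p.2), p.1, x * p.2,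
        Ideal.mem_span_singleton.mpr ⟨p.2, rfl⟩, rfl⟩
      map_add' := fun p q => by
        apply Subtype.ext
        change (p.1 + q.1, p.1 + q.1 + x * (p.2 + q.2)) =
          (p.1 + q.1, (p.1 + x * p.2) + (q.1 + x * q.2))
        rw [Prod.mk.injEq]
        exact ⟨rfl, by ring⟩
      map_smul' := fun r p => by
        apply Subtype.ext
        change (r * p.1, r * p.1 + x * (r * p.2)) = (r * p.1, r * (p.1 + x * p.2))
        rw [Prod.mk.injEq]
        exact ⟨rfl, by ring⟩ }
  refine Module.Free.of_equiv (LinearEquiv.ofBijective f ⟨?_, ?_⟩)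
  · rintro ⟨a, b⟩ ⟨c, d⟩ h
    have h' := congrArg Subtype.val h
    change (a, a + x * b) = (c, c + x * d) at h'
    rw [Prod.mk.injEq] at h'
    obtain ⟨rfl, h2⟩ := h'
    have h3 := add_left_cancel h2
    rw [mul_cancel_left_mem_nonZeroDivisors hx] at h3
    rw [h3]
  · rintro ⟨_, r, e, he, rfl⟩
    obtain ⟨c, rfl⟩ := Ideal.mem_span_singleton.mp he
    exact ⟨(r, c), rfl⟩

lemma GD_amalg_iff {R : Type u} [CommRing R] (x : R) (hx : x ∈ nonZeroDivisors R) (n : ℕ) :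
    GD.{u, u} (amalg R (Ideal.span {x})) n ↔ GD.{u, u} R n := by
  constructor
  · intro h
    have := amalg_free x hx
    exact GD_of_retract ((AlgHom.fst R R R).comp (amalg R (Ideal.span {x})).val) n h
  · intro h
    refine @GD_patch (amalg R (Ideal.span {x})) R R _ _
      ((AlgHom.fst R R R).comp (amalg R (Ideal.span {x})).val).toRingHom.toAlgebra _
      ((AlgHom.snd R R R).comp (amalg R (Ideal.span {x})).val).toRingHom.toAlgebra
      ?_ ?_ ?_ n h h
    · intro r
      exact ⟨⟨(r, r), r, 0, zero_mem _, by simp⟩, rfl⟩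
    · intro r
      exact ⟨⟨(r, r), r, 0, zero_mem _, by simp⟩, rfl⟩
    · intro a b ha hb
      change a.1.1 = 0 at ha
      change b.1.2 = 0 at hb
      apply Subtype.ext
      apply Prod.ext
      · change a.1.1 * b.1.1 = 0
        rw [ha, zero_mul]
      · change a.1.2 * b.1.2 = 0
        rw [hb, mul_zero]

lemma ext_iff_GD {R : Type u} [CommRing R] (n : ℕ) :
    (∀ F M : ModuleCat.{max u v} R, Module.Flat R F →
        Subsingleton (((Ext R (ModuleCat.{max u v} R) (n + 1)).obj (Opposite.op F)).obj M)) ↔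
      GD.{u, u} R n := by
  constructor
  · intro h
    exact GD_down.{u, v} R n fun F hF => (bridge.{u, max u v} F n).1 fun M => h F M hF
  · intro h F M hF
    exact (bridge.{u, max u v} F n).2 (GD_up.{u, max u v} R n h F hF) M

end Helpers

/-- for x regular, the global cotorsion dimension of R⋈xR equals that of
R: for each n, Ext^{n+1}(F,M) vanishes for every flat F and every M over R⋈xR iff the
same holds over R. -/
theorem cotorsion_dimension_amalg (R : Type u) [CommRing R] (x : R)
    (hx : x ∈ nonZeroDivisors R) :
    ∀ n : ℕ,
      (∀ F M : ModuleCat (amalg R (Ideal.span {x})), Module.Flat (amalg R (Ideal.span {x})) F →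
        Subsingleton (((Ext (amalg R (Ideal.span {x}))
            (ModuleCat (amalg R (Ideal.span {x}))) (n + 1)).obj
          (Opposite.op F)).obj M)) ↔
      (∀ F M : ModuleCat R, Module.Flat R F →
        Subsingleton (((Ext R (ModuleCat R) (n + 1)).obj (Opposite.op F)).obj M)) := by
  intro n
  exact (ext_iff_GD n).trans ((GD_amalg_iff x hx n).trans (ext_iff_GD n).symm)
end

section
/- Let R be a commutative ring, x ∈ R a regular element, and M an R-module with finite projective dimension over R. Then M ⊗_R (R⋈xR) has finite projective dimension over R⋈xR, and in fact pd_{R⋈xR}(M ⊗_R (R⋈xR)) ≤ pd_R(M), with pd_R(M) = pd_R(M ⊗_R (R⋈xR)) since R⋈xR ≅ R² as R-modules. -/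
open CategoryTheory
open scoped TensorProduct

set_option synthInstance.maxHeartbeats 1000000
set_option maxHeartbeats 1000000


namespace PdAux

universe v

/-- Vanishing of the derived-functor `Ext` in degree `n + 1`, on a projective resolution. -/
lemma subsingleton_old_iff {R : Type v} [CommRing R] {X : ModuleCat.{v} R}
    (P : ProjectiveResolution X) (n : ℕ) (Y : ModuleCat.{v} R) :
    Subsingleton (((Ext R (ModuleCat.{v} R) (n + 1)).obj (Opposite.op X)).obj Y) ↔
      ∀ f : P.complex.X (n + 1) ⟶ Y, P.complex.d (n + 2) (n + 1) ≫ f = 0 →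
        ∃ g : P.complex.X n ⟶ Y, P.complex.d (n + 1) n ≫ g = f := by
  rw [← ModuleCat.isZero_iff_subsingleton, (P.isoExt (R := R) (n + 1) Y).isZero_iff,
    ← HomologicalComplex.exactAt_iff_isZero_homology,
    HomologicalComplex.exactAt_iff' _ n (n + 1) (n + 2) (by simp) (by simp),
    ShortComplex.moduleCat_exact_iff]
  exact Iff.rfl

lemma subsingleton_new_iff {R : Type v} [CommRing R] {X : ModuleCat.{v} R}
    (P : ProjectiveResolution X) (n : ℕ) (Y : ModuleCat.{v} R) :
    Subsingleton (Abelian.Ext X Y (n + 1)) ↔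
      ∀ f : P.complex.X (n + 1) ⟶ Y, P.complex.d (n + 2) (n + 1) ≫ f = 0 →
        ∃ g : P.complex.X n ⟶ Y, P.complex.d (n + 1) n ≫ g = f := by
  constructor
  · intro h f hf
    exact (P.extMk_eq_zero_iff f (n + 2) rfl hf n rfl).1 (Subsingleton.elim _ _)
  · intro h
    refine subsingleton_of_forall_eq 0 fun a => ?_
    obtain ⟨f, hf, rfl⟩ := P.extMk_surjective a (n + 2) rfl
    exact (P.extMk_eq_zero_iff f (n + 2) rfl hf n rfl).2 (h f hf)

lemma pd_iff {R : Type v} [CommRing R] (X : ModuleCat.{v} R) (n : ℕ) :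
    (∀ Y : ModuleCat.{v} R,
      Subsingleton (((Ext R (ModuleCat.{v} R) (n + 1)).obj (Opposite.op X)).obj Y)) ↔
      HasProjectiveDimensionLE X n := by
  have P : ProjectiveResolution X := ProjectiveResolution.of X
  simp only [subsingleton_old_iff P, ← subsingleton_new_iff P]
  constructor
  · exact hasProjectiveDimensionLT_of_enoughInjectives X (n + 1)
  · intro h Y
    exact HasProjectiveDimensionLT.subsingleton X (n + 1) (n + 1) le_rfl Y

lemma exact_aux {R : Type v} [CommRing R] (S : Type v) [AddCommGroup S] [Module R S]
    {A B C : Type v} [AddCommGroup A] [AddCommGroup B] [AddCommGroup C]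
    [Module R A] [Module R B] [Module R C] (f : A →ₗ[R] B) (g : B →ₗ[R] C)
    (h : Function.Exact f g) (hg : Function.Surjective g) :
    Function.Exact (LinearMap.lTensor S f) (LinearMap.lTensor S g) :=
  lTensor_exact S h hg

lemma comp_aux {R : Type v} [CommRing R] (S : Type v) [CommRing S] [Algebra R S]
    {F M : Type v} [AddCommGroup F] [Module R F] [AddCommGroup M] [Module R M] (f : F →ₗ[R] M) :
    ModuleCat.ofHom ((LinearMap.ker f).subtype.baseChange S) ≫
      ModuleCat.ofHom (f.baseChange S) = 0 := by
  rw [← ModuleCat.ofHom_comp, ← LinearMap.baseChange_comp]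
  have : f ∘ₗ (LinearMap.ker f).subtype = 0 := by ext x; simp
  rw [this, LinearMap.baseChange_zero]
  rfl

lemma shortExact_aux {R : Type v} [CommRing R] (S : Type v) [CommRing S] [Algebra R S]
    [Module.Flat R S] {F M : Type v} [AddCommGroup F] [Module R F] [AddCommGroup M] [Module R M]
    (f : F →ₗ[R] M) (hf : Function.Surjective f) :
    (ShortComplex.mk _ _ (comp_aux S f)).ShortExact := by
  apply ModuleCat.shortComplex_shortExact
  · exact exact_aux S (LinearMap.ker f).subtype f (LinearMap.exact_subtype_ker_map f) hf
  · exact Module.Flat.lTensor_preserves_injective_linearMap (M := S) _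
      (LinearMap.ker f).injective_subtype
  · exact LinearMap.lTensor_surjective S hf

lemma baseChange {R S : Type v} [CommRing R] [CommRing S] [Algebra R S] [Module.Flat R S]
    (n : ℕ) (M : Type v) [AddCommGroup M] [Module R M]
    (h : HasProjectiveDimensionLE (ModuleCat.of R M) n) :
    HasProjectiveDimensionLE (ModuleCat.of S (S ⊗[R] M)) n := by
  induction n generalizing M with
  | zero =>
    simp only [HasProjectiveDimensionLE, zero_add] at h ⊢
    rw [← projective_iff_hasProjectiveDimensionLT_one, ← IsProjective.iff_projective] at h ⊢
    have : Module.Projective R M := h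
    exact (inferInstance : Module.Projective S (S ⊗[R] M))
  | succ n ih =>
    let f : (M →₀ R) →ₗ[R] M := Finsupp.linearCombination R id
    have hf : Function.Surjective f := Finsupp.linearCombination_id_surjective R M
    have T := LinearMap.shortExact_shortComplexKer hf
    have hp : Projective (ModuleCat.of R (M →₀ R)) :=
      (IsProjective.iff_projective _).1 inferInstance
    have hp' : Projective (ModuleCat.of S (S ⊗[R] (M →₀ R))) :=
      (IsProjective.iff_projective _).1 inferInstance
    have h1 := (T.hasProjectiveDimensionLT_X₃_iff n hp).mp h
    have h2 := ih (LinearMap.ker f) h1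
    exact ((shortExact_aux S f hf).hasProjectiveDimensionLT_X₃_iff n hp').mpr h2

/-- `R ⋈ xR` is free of rank two for `x` regular. -/
noncomputable def amalgEquiv (R : Type v) [CommRing R] (x : R) (hx : x ∈ nonZeroDivisors R) :
    (R × R) ≃ₗ[R] amalg R (Ideal.span {x}) :=
  LinearEquiv.ofBijective
    { toFun := fun p => ⟨(p.1, p.1 + x * p.2), p.1, x * p.2,
        Ideal.mem_span_singleton.mpr ⟨p.2, rfl⟩, rfl⟩
      map_add' := by
        intro p q
        apply Subtype.ext
        simp [Prod.ext_iff]; ring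
      map_smul' := by
        intro r p
        apply Subtype.ext
        simp [Prod.ext_iff]; ring }
    (by
      constructor
      · rintro ⟨a, b⟩ ⟨c, d⟩ h
        have h := congrArg Subtype.val h
        simp only [LinearMap.coe_mk, AddHom.coe_mk, Prod.mk.injEq] at h
        obtain ⟨rfl, h⟩ := h
        have h := add_left_cancel h
        rw [mul_cancel_left_mem_nonZeroDivisors hx] at h
        rw [h]
      · rintro ⟨p, r, e, he, rfl⟩
        obtain ⟨c, rfl⟩ := Ideal.mem_span_singleton.mp he
        exact ⟨(r, c), rfl⟩)

end PdAux

/-- for x regular and M an R-module of finite projective dimension,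
M ⊗_R (R⋈xR) has finite projective dimension over R⋈xR, with
pd_{R⋈xR}(M ⊗_R (R⋈xR)) ≤ pd_R(M), and pd_R(M) = pd_R(M ⊗_R (R⋈xR))
(projective dimension ≤ n expressed by Ext^{n+1}-vanishing). -/
theorem pd_base_change_amalg (R : Type u) [CommRing R] (x : R)
    (hx : x ∈ nonZeroDivisors R) (M : Type u) [AddCommGroup M] [Module R M]
    (hpd : ∃ n : ℕ, ∀ N : ModuleCat R,
      Subsingleton (((Ext R (ModuleCat R) (n + 1)).obj
        (Opposite.op (ModuleCat.of R M))).obj N)) :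
    (∃ n : ℕ, ∀ N : ModuleCat (amalg R (Ideal.span {x})),
      Subsingleton (((Ext (amalg R (Ideal.span {x}))
          (ModuleCat (amalg R (Ideal.span {x}))) (n + 1)).obj
        (Opposite.op (ModuleCat.of (amalg R (Ideal.span {x}))
          (amalg R (Ideal.span {x}) ⊗[R] M)))).obj N)) ∧
    (∀ n : ℕ,
      (∀ N : ModuleCat R,
        Subsingleton (((Ext R (ModuleCat R) (n + 1)).obj
          (Opposite.op (ModuleCat.of R M))).obj N)) →
      (∀ N : ModuleCat (amalg R (Ideal.span {x})),
        Subsingleton (((Ext (amalg R (Ideal.span {x}))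
            (ModuleCat (amalg R (Ideal.span {x}))) (n + 1)).obj
          (Opposite.op (ModuleCat.of (amalg R (Ideal.span {x}))
            (amalg R (Ideal.span {x}) ⊗[R] M)))).obj N))) ∧
    (∀ n : ℕ,
      (∀ N : ModuleCat R,
        Subsingleton (((Ext R (ModuleCat R) (n + 1)).obj
          (Opposite.op (ModuleCat.of R M))).obj N)) ↔
      (∀ N : ModuleCat R,
        Subsingleton (((Ext R (ModuleCat R) (n + 1)).obj
          (Opposite.op (ModuleCat.of R (amalg R (Ideal.span {x}) ⊗[R] M)))).obj N))) := by
  have : Module.Free R (amalg R (Ideal.span {x})) :=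
    Module.Free.of_equiv (PdAux.amalgEquiv R x hx)
  have key : ∀ n : ℕ, HasProjectiveDimensionLE (ModuleCat.of R M) n →
      HasProjectiveDimensionLE (ModuleCat.of (amalg R (Ideal.span {x}))
        (amalg R (Ideal.span {x}) ⊗[R] M)) n := fun n h => PdAux.baseChange n M h
  simp only [PdAux.pd_iff] at hpd ⊢
  refine ⟨hpd.imp key, key, fun n => ?_⟩
  let e : (amalg R (Ideal.span {x}) ⊗[R] M) ≃ₗ[R] (M × M) :=
    (TensorProduct.congr (PdAux.amalgEquiv R x hx).symm (LinearEquiv.refl R M)).trans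
      ((TensorProduct.prodLeft R R R R M).trans
        ((TensorProduct.lid R M).prodCongr (TensorProduct.lid R M)))
  constructor
  · intro h
    have h2 : HasProjectiveDimensionLT (ModuleCat.of R M ⊞ ModuleCat.of R M) (n + 1) :=
      inferInstance
    exact hasProjectiveDimensionLT_of_iso
      (ModuleCat.biprodIsoProd (ModuleCat.of R M) (ModuleCat.of R M) ≪≫ e.symm.toModuleIso) _
  · intro h
    let r : Retract (ModuleCat.of R M) (ModuleCat.of R (amalg R (Ideal.span {x}) ⊗[R] M)) :=
      { i := ModuleCat.ofHom (e.symm.toLinearMap ∘ₗ LinearMap.inl R M M)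
        r := ModuleCat.ofHom (LinearMap.fst R M M ∘ₗ e.toLinearMap)
        retract := by
          ext m
          simp }
    exact r.hasProjectiveDimensionLT (n + 1)
end
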